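/- Let q be a twinless path 2-CQ with t_1 ≺ f_1; write t_□ for the last T-node of q preceding f_1, t_△ for the first T-node of q succeeding f_1 (when f_1 ≺ t_last), and t_{last−1} for the last-but-one T-node of q. Let B be an n-bike for q with n ≥ 4|q| + 2, built from n-cogwheels W_• and W_∘ each satisfying cogwheel conditions (i) and (ii), whose contact choices are as follows. T-connections: c_T^• = t_1, and c_T^∘ = t_△ if f_1 ≺ t_last, while c_T^∘ = t_last if t_last ≺ f_1. T-neighbourhood: in W_•, the contact c_T^{j_•} is the copy of t_□, and c_F^{j_•} is the copy of f_1 if f_1 ≺ t_last and the copy of f_2 if t_last ≺ f_1; in W_∘, c_T^{j_∘} is the copy of t_1, and c_F^{j_∘} is the copy of f_2 if t_last ≺ f_1 and δ(t_{last−1}, t_last) = δ(t_last, f_1), and the copy of f_1 otherwise; for every other index k with j_* − |q| ≤ k ≤ j_* + |q| (for ∗ ∈ {•, ∘}), c_T^k is the copy of t_1 and c_F^k is the copy of f_1. F-connections: c_F^• = f_1 and c_F^∘ = f_2. F-neighbourhood, for ∗ ∈ {•, ∘}: c_T^{i_*} is the copy of t_1 and c_F^{i_*} is the copy of f_2; for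 0 < k ≤ |q|, c_T^{i_*−k} is the copy of t_1 and c_F^{i_*−k} is the copy of f_1; for 1 ≤ ℓ ≤ |q|, c_T^{i_*+ℓ} is the copy of t_1 if t_last ≺ f_1 and δ(f_1, f_2) < δ(t_1, f_1), and the copy of t_□ otherwise, while c_F^{i_*+ℓ} is the copy of f_2 if t_last ≺ f_1 and δ(f_1, f_2) ≥ δ(t_1, f_1), and the copy of f_1 otherwise. Then for every minimal model I of cov_A and B: I does not satisfy q if and only if either all contacts of W_• are in the interpretation of T and all contacts of W_∘ are in the interpretation of F, or all contacts of W_• are in the interpretation of F and all contacts of W_∘ are in the interpretation of T. -/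

import Mathlib

attribute [local instance] Classical.propDecidable

namespace DS

/-- Ground/query atoms over binary-predicate alphabet `σ` and node type `α`:
unary predicates `F`, `T`, `A` and binary predicates `R r`. -/
inductive At (σ α : Type) : Type
  | F : α → At σ α
  | T : α → At σ α
  | A : α → At σ α
  | R : σ → α → α → At σ α

namespace At

/-- Renaming of the nodes of an atom. -/
def map {σ α β : Type} (h : α → β) : At σ α → At σ β
  | .F a => .F (h a)
  | .T a => .T (h a)
  | .A a => .A (h a)
  | .R r a b => .R r (h a) (h b)

/-- The nodes occurring in an atom. -/
def vars {σ α : Type} : At σ α → Set α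
  | .F a => {a}
  | .T a => {a}
  | .A a => {a}
  | .R _ a b => {a, b}

end At

/-- An interpretation over domain `δ`. -/
structure Interp (σ δ : Type) where
  FS : δ → Prop
  TS : δ → Prop
  AS : δ → Prop
  RS : σ → δ → δ → Prop

/-- Truth of an atom in an interpretation. -/
def Interp.satAt {σ δ : Type} (I : Interp σ δ) : At σ δ → Prop
  | .F a => I.FS a
  | .T a => I.TS a
  | .A a => I.AS a
  | .R r a b => I.RS r a b

/-- `I ⊨ q`: there is a homomorphism from the Boolean CQ `q` into `I`. -/
def Interp.satCQ {σ δ V : Type} (I : Interp σ δ) (q : Set (At σ V)) : Prop :=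
  ∃ h : V → δ, ∀ a ∈ q, I.satAt (At.map h a)

/-- An ABox viewed as an interpretation over its own individuals. -/
def toInterp {σ α : Type} (A : Set (At σ α)) : Interp σ α where
  FS a := At.F a ∈ A
  TS a := At.T a ∈ A
  AS a := At.A a ∈ A
  RS r a b := At.R r a b ∈ A

/-- An individual is undecided if it is labelled `A` but neither `F` nor `T`. -/
def undecided {σ α : Type} (A : Set (At σ α)) (a : α) : Prop :=
  At.A a ∈ A ∧ At.F a ∉ A ∧ At.T a ∉ A

/-- The minimal model of `cov_A` and the ABox `A` determined by a choice `c` of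
one of `F`/`T` for each undecided `A`-individual. -/
def minModel {σ α : Type} (A : Set (At σ α)) (c : α → Bool) : Interp σ α where
  FS a := At.F a ∈ A ∨ (undecided A a ∧ c a = true)
  TS a := At.T a ∈ A ∨ (undecided A a ∧ c a = false)
  AS a := At.A a ∈ A
  RS r a b := At.R r a b ∈ A

/-- `F` and `T` are interpreted disjointly. -/
def disjointFT {σ δ : Type} (I : Interp σ δ) : Prop := ∀ d : δ, ¬ (I.FS d ∧ I.TS d)

/-- Certain answer to the OMQ `(cov_A, q)` over the ABox `A`:
`q` holds in every minimal model of `cov_A` and `A`. -/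
def covACert {σ α V : Type} (A : Set (At σ α)) (q : Set (At σ V)) : Prop :=
  ∀ c : α → Bool, (minModel A c).satCQ q

/-- Certain answer to the OMQ `(cov_A^⊥, q)` over the ABox `A`:
`q` holds in every minimal model of `cov_A^⊥` and `A` (the minimal models of
`cov_A` in which `F` and `T` are disjoint). -/
def covABotCert {σ α V : Type} (A : Set (At σ α)) (q : Set (At σ V)) : Prop :=
  ∀ c : α → Bool, disjointFT (minModel A c) → (minModel A c).satCQ q

/-- No `FT`-twin occurs. -/
def twinFree {σ α : Type} (A : Set (At σ α)) : Prop :=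
  ∀ a : α, ¬ (At.F a ∈ A ∧ At.T a ∈ A)

/-- A CQ does not use the unary predicate `A`. -/
def noA {σ V : Type} (q : Set (At σ V)) : Prop := ∀ v : V, At.A v ∉ q

/-- `x` occurs in `q`. -/
def occ {σ V : Type} (q : Set (At σ V)) (x : V) : Prop := ∃ a ∈ q, x ∈ At.vars a

/-- Connectedness of a CQ. -/
def connCQ {σ V : Type} (q : Set (At σ V)) : Prop :=
  ∀ x y : V, occ q x → occ q y →
    Relation.ReflTransGen (fun u v => ∃ a ∈ q, u ∈ At.vars a ∧ v ∈ At.vars a) x y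

/-- Solitary `F`-node of a CQ. -/
def solF {σ V : Type} (q : Set (At σ V)) (x : V) : Prop := At.F x ∈ q ∧ At.T x ∉ q

/-- Solitary `T`-node of a CQ. -/
def solT {σ V : Type} (q : Set (At σ V)) (y : V) : Prop := At.T y ∈ q ∧ At.F y ∉ q
/-- The path CQ with `m` edges labelled `ρ 0, …, ρ (m-1)` along the nodes
`0, 1, …, m`, whose `F`-nodes are the elements of `FL` and whose `T`-nodes are
the elements of `TL`. -/
def pathCQ (σ : Type) (m : ℕ) (ρ : ℕ → σ) (FL TL : Set ℕ) : Set (At σ ℕ) :=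
  {a | (∃ i, i < m ∧ a = At.R (ρ i) i (i + 1)) ∨
       (∃ i ∈ FL, a = At.F i) ∨ (∃ i ∈ TL, a = At.T i)}
/-- Gluing normalisation for the nodes of an `n`-cogwheel: the chosen `T`-node
of copy `j` is glued to (identified with) the chosen `F`-node of copy `j - 1`. -/
def wheelNorm (n : ℕ) (cT cF : ZMod n → ℕ) (p : ZMod n × ℕ) : ZMod n × ℕ :=
  if p.2 = cT p.1 then (p.1 - 1, cF (p.1 - 1)) else p

/-- The copy of `q` used in a cogwheel: the labels `T`/`F` of the two chosen
contact nodes are replaced by `A`. -/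
def contactCopy {σ : Type} (q : Set (At σ ℕ)) (tpos fpos : ℕ) : Set (At σ ℕ) :=
  insert (At.A tpos) (insert (At.A fpos) (q \ {At.T tpos, At.F fpos}))

/-- The `n`-cogwheel for the path CQ `q` with contact choices `cT j ∈ TL`,
`cF j ∈ FL` (in the `j`-th copy of `q`): the `n` copies are arranged in a cycle,
gluing the `F`-contact of copy `j` to the `T`-contact of copy `j + 1`. -/
def cogwheel (σ : Type) (n : ℕ) (q : Set (At σ ℕ)) (cT cF : ZMod n → ℕ) :
    Set (At σ (ZMod n × ℕ)) :=
  {a | ∃ j : ZMod n, ∃ b ∈ contactCopy q (cT j) (cF j),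
        a = At.map (fun v => wheelNorm n cT cF (j, v)) b}

/-- The contact-distance between the contacts with indices `a` and `b`. -/
def cdist {n : ℕ} (a b : ZMod n) : ℕ := min (ZMod.val (a - b)) (ZMod.val (b - a))
/-- The first `T`-node `t₁` of a path CQ with `T`-nodes `TL`. -/
noncomputable def fstT (TL : Set ℕ) : ℕ := sInf TL

/-- The first `F`-node `f₁`. -/
noncomputable def fstF (FL : Set ℕ) : ℕ := sInf FL

/-- The second `F`-node `f₂`. -/
noncomputable def sndF (FL : Set ℕ) : ℕ := sInf (FL \ {sInf FL})

/-- The last `T`-node `t_last`. -/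
noncomputable def lastT (TL : Set ℕ) : ℕ := sSup TL

/-- The last-but-one `T`-node `t_{last−1}`. -/
noncomputable def last1T (TL : Set ℕ) : ℕ := sSup (TL \ {sSup TL})

/-- `t_□`: the last `T`-node preceding `f₁`. -/
noncomputable def boxT (FL TL : Set ℕ) : ℕ := sSup {t | t ∈ TL ∧ t < fstF FL}

/-- `t_△`: the first `T`-node succeeding `f₁`. -/
noncomputable def triT (FL TL : Set ℕ) : ℕ := sInf {t | t ∈ TL ∧ fstF FL < t}

/-- The individuals of an `n`-bike: nodes of the two wheels (tagged by a
`Bool`: `true` for `W_•`, `false` for `W_∘`), and the non-glued nodes of the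
connecting copies `q_F` (tag `false`) and `q_T` (tag `true`). -/
abbrev BInd (n : ℕ) : Type := (Bool × ZMod n × ℕ) ⊕ (Bool × ℕ)

/-- Gluing normalisation inside the wheel `w` of a bike. -/
def bwNorm (n : ℕ) (cT cF : Bool → ZMod n → ℕ) (w : Bool) (j : ZMod n) (v : ℕ) :
    Bool × ZMod n × ℕ :=
  if v = cT w j then (w, j - 1, cF w (j - 1)) else (w, j, v)

/-- The renaming of the copy `q_F`: its node `ff1` (= `c_F^•`) is glued to the
contact with index `iB •` of `W_•`, its node `ff2` (= `c_F^∘`) to the contact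
with index `iB ∘` of `W_∘`; other nodes are fresh. -/
def embF (n : ℕ) (cF : Bool → ZMod n → ℕ) (iB : Bool → ZMod n)
    (ff1 ff2 : ℕ) (v : ℕ) : BInd n :=
  if v = ff1 then Sum.inl (true, iB true, cF true (iB true))
  else if v = ff2 then Sum.inl (false, iB false, cF false (iB false))
  else Sum.inr (false, v)

/-- The renaming of the copy `q_T`: its node `tt1` (= `c_T^•`) is glued to the
contact with index `jB •` of `W_•`, its node `tt2` (= `c_T^∘`) to the contact
with index `jB ∘` of `W_∘`; other nodes are fresh. -/
def embT (n : ℕ) (cF : Bool → ZMod n → ℕ) (jB : Bool → ZMod n)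
    (tt1 tt2 : ℕ) (v : ℕ) : BInd n :=
  if v = tt1 then Sum.inl (true, jB true, cF true (jB true))
  else if v = tt2 then Sum.inl (false, jB false, cF false (jB false))
  else Sum.inr (true, v)

/-- The `n`-bike for `q` built from the two `n`-cogwheels with contact choices
`cT w`, `cF w` and the copies `q_F` (with the `F`-labels of `ff1 ≺ ff2` replaced
by `A`, glued to the contacts `iB w`) and `q_T` (with the `T`-labels of
`tt1 ≺ tt2` replaced by `A`, glued to the contacts `jB w`). -/
def bike (σ : Type) (n : ℕ) (q : Set (At σ ℕ)) (cT cF : Bool → ZMod n → ℕ)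
    (iB jB : Bool → ZMod n) (ff1 ff2 tt1 tt2 : ℕ) : Set (At σ (BInd n)) :=
  {a | ∃ w j, ∃ b ∈ contactCopy q (cT w j) (cF w j),
        a = At.map (fun v => Sum.inl (bwNorm n cT cF w j v)) b} ∪
  (At.map (embF n cF iB ff1 ff2) ''
    (insert (At.A ff1) (insert (At.A ff2) (q \ {At.F ff1, At.F ff2})))) ∪
  (At.map (embT n cF jB tt1 tt2) ''
    (insert (At.A tt1) (insert (At.A tt2) (q \ {At.T tt1, At.T tt2}))))


/-- F-lemma: dynamics of a piecewise shift. -/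
theorem shift_aux (m : ℤ) (d : ℤ → ℤ) (S : ℤ → Prop) (hm : 0 < m)
    (hS : ∀ x, S x → x ≤ m)
    (h0 : 0 < d 0) (h1 : d (m - 1) < 0)
    (hlo : ∀ y, 1 ≤ y → y ≤ m - 1 → d y ≠ d (y - 1) → 0 ≤ y + d y)
    (hsw : ∀ y, 1 ≤ y → y ≤ m - 1 → d y ≠ d (y - 1) → S (y + d (y - 1)) ∧ ¬ S y)
    (hcl : ∀ x, 1 ≤ x → x ≤ m → S x → S (x + d (x - 1))) : False := by
  classical
  set g : ℤ → ℤ := fun x => x + d (x - 1) with hg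
  -- the switch times
  set W : Finset ℤ := (Finset.Icc 1 (m - 1)).filter (fun y => d y ≠ d (y - 1)) with hW
  have memW : ∀ y, y ∈ W ↔ (1 ≤ y ∧ y ≤ m - 1) ∧ d y ≠ d (y - 1) := by
    intro y; simp [hW]
  -- there is a drop
  have hdrop : ∃ y ∈ W, d y < d (y - 1) := by
    by_contra hcon
    push Not at hcon
    have key : ∀ k : ℕ, (k : ℤ) ≤ m - 1 → d 0 ≤ d k := by
      intro k
      induction k with
      | zero => intro _; simp
      | succ k ih =>
        intro hk
        push_cast at hk ⊢
        have h2 := ih (by omega)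
        by_cases he : d ((k : ℤ) + 1) = d ((k : ℤ) + 1 - 1)
        · rw [he]; simpa using h2
        · have := hcon ((k : ℤ) + 1) ((memW _).2 ⟨⟨by omega, by omega⟩, he⟩)
          simp only [add_sub_cancel_right] at this
          omega
    have := key (m - 1).toNat (by omega)
    rw [Int.toNat_of_nonneg (by omega)] at this
    omega
  obtain ⟨y0, hy0, hy0d⟩ := hdrop
  have hWne : W.Nonempty := ⟨y0, hy0⟩
  obtain ⟨yM, hyM, hM⟩ := W.exists_max_image g hWne
  obtain ⟨yL, hyL, hL⟩ := W.exists_min_image (fun y => y + d y) hWne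
  set M := g yM with hMdef
  set lo := yL + d yL with hlodef
  have hMm : M ≤ m := by
    have := (memW yM).1 hyM
    exact hS _ (hsw yM this.1.1 this.1.2 this.2).1
  have hlo0 : 0 ≤ lo := by
    have := (memW yL).1 hyL
    exact hlo yL this.1.1 this.1.2 this.2
  have hloM : lo < M := by
    have a := hL y0 hy0
    have b := hM y0 hy0
    simp only [hg] at a b hMdef
    omega
  -- next switch
  have next : ∀ k : ℕ, ∀ x, 1 ≤ x → x + k = m →
      (∃ y ∈ W, x ≤ y ∧ d (y - 1) = d (x - 1)) ∨ d (x - 1) = d (m - 1) := by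
    intro k
    induction k with
    | zero => intro x hx hk; right; congr 1; push_cast at hk; omega
    | succ k ih =>
      intro x hx hk
      push_cast at hk
      by_cases he : d x = d (x - 1)
      · rcases ih (x + 1) (by omega) (by omega) with ⟨y, hy, hxy, hd⟩ | hd
        · left; refine ⟨y, hy, by omega, ?_⟩; rw [hd, add_sub_cancel_right, he]
        · right; rw [add_sub_cancel_right, he] at hd; exact hd
      · left; exact ⟨x, (memW x).2 ⟨⟨hx, by omega⟩, he⟩, le_refl _, rfl⟩
  have prev : ∀ k : ℕ, ((k : ℤ) + 1) ≤ m →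
      (∃ y ∈ W, y < (k : ℤ) + 1 ∧ d y = d k) ∨ d k = d 0 := by
    intro k
    induction k with
    | zero => intro _; right; simp
    | succ k ih =>
      intro hk
      push_cast at hk ⊢
      by_cases he : d ((k : ℤ) + 1) = d k
      · rcases ih (by omega) with ⟨y, hy, hxy, hd⟩ | hd
        · left; exact ⟨y, hy, by omega, by rw [hd, he]⟩
        · right; rw [he, hd]
      · left
        refine ⟨(k : ℤ) + 1, (memW _).2 ⟨⟨by omega, by omega⟩, ?_⟩, by omega, rfl⟩
        simpa using he
  have up : ∀ x, lo < x → x ≤ M → g x ≤ M ∧ (g x = M → x ∈ W) := by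
    intro x hx1 hx2
    rcases next (m - x).toNat x (by omega) (by omega) with ⟨y, hy, hxy, hd⟩ | hd
    · have hb := hM y hy
      simp only [hg] at hb hMdef ⊢
      constructor
      · omega
      · intro he
        have : x = y := by omega
        rw [this]; exact hy
    · simp only [hg] at hMdef ⊢
      constructor
      · omega
      · intro he; omega
  have down : ∀ x, lo < x → x ≤ M → lo < g x := by
    intro x hx1 hx2
    have hk : ((x - 1).toNat : ℤ) = x - 1 := by omega
    rcases prev (x - 1).toNat (by omega) with ⟨y, hy, hxy, hd⟩ | hd
    · rw [hk] at hd
      have hb := hL y hy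
      simp only [hg] at hb ⊢
      omega
    · rw [hk] at hd
      simp only [hg]
      omega
  have inv : ∀ x, (lo < x ∧ x ≤ M) → (lo < g x ∧ g x ≤ M) := fun x hx =>
    ⟨down x hx.1 hx.2, (up x hx.1 hx.2).1⟩
  have invN : ∀ (N : ℕ) x, (lo < x ∧ x ≤ M) → (lo < g^[N] x ∧ g^[N] x ≤ M) := by
    intro N
    induction N with
    | zero => intro x hx; simpa using hx
    | succ N ih => intro x hx; rw [Function.iterate_succ_apply']; exact inv _ (ih x hx)
  -- periodic points
  set Pp : Finset ℤ := (Finset.Ioc lo M).filter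
    (fun x => ∃ N : ℕ, 0 < N ∧ g^[N] x = x) with hPp
  have memP : ∀ x, x ∈ Pp ↔ (lo < x ∧ x ≤ M) ∧ ∃ N : ℕ, 0 < N ∧ g^[N] x = x := by
    intro x; simp [hPp]
  have Pne : Pp.Nonempty := by
    have hfin : ¬ Function.Injective (fun N : ℕ => (⟨g^[N] M, Finset.mem_Ioc.2 (invN N M ⟨hloM, le_refl _⟩)⟩ : {x // x ∈ Finset.Ioc lo M})) :=
      not_injective_infinite_finite _
    simp only [Function.Injective, not_forall] at hfin
    obtain ⟨a, b, hab, hne⟩ := hfin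
    have hab' : g^[a] M = g^[b] M := by simpa using hab
    rcases lt_or_gt_of_ne hne with h | h
    · refine ⟨g^[a] M, (memP _).2 ⟨invN a M ⟨hloM, le_refl _⟩, b - a, by omega, ?_⟩⟩
      rw [← Function.iterate_add_apply, Nat.sub_add_cancel h.le, hab']
    · refine ⟨g^[b] M, (memP _).2 ⟨invN b M ⟨hloM, le_refl _⟩, a - b, by omega, ?_⟩⟩
      rw [← Function.iterate_add_apply, Nat.sub_add_cancel h.le, hab']
  have Pinv : ∀ x ∈ Pp, g x ∈ Pp := by
    intro x hx
    obtain ⟨h1, N, hN, hx2⟩ := (memP x).1 hx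
    refine (memP _).2 ⟨inv x h1, N, hN, ?_⟩
    rw [← Function.iterate_succ_apply, Function.iterate_succ_apply', hx2]
  have Pinvn : ∀ (N : ℕ) x, x ∈ Pp → g^[N] x ∈ Pp := by
    intro N
    induction N with
    | zero => intro x hx; simpa using hx
    | succ N ih => intro x hx; rw [Function.iterate_succ_apply']; exact Pinv _ (ih x hx)
  -- no switch is periodic
  have noS : ∀ x ∈ Pp, x ∉ W := by
    intro x hx hxW
    obtain ⟨h1, N, hN, hx2⟩ := (memP x).1 hx
    obtain ⟨hx3, hx4⟩ := (memW x).1 hxW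
    obtain ⟨hx5, hx6⟩ := hsw x hx3.1 hx3.2 hx4
    apply hx6
    have : ∀ k : ℕ, S (g^[k] (g x)) := by
      intro k
      induction k with
      | zero => exact hx5
      | succ k ih =>
        rw [Function.iterate_succ_apply']
        have := invN k (g x) (inv x h1)
        exact hcl _ (by omega) (by omega) ih
    have h3 := this (N - 1)
    rw [← Function.iterate_succ_apply, Nat.succ_eq_add_one, Nat.sub_add_cancel hN, hx2] at h3
    exact h3
  obtain ⟨b, hb, hbmax⟩ := Pp.exists_max_image id Pne
  simp only [id] at hbmax
  obtain ⟨hb1, N, hN, hbN⟩ := (memP b).1 hb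
  rcases lt_or_eq_of_le hb1.2 with hlt | heq
  · have tr : ∀ k : ℕ, g^[k] (b + 1) = g^[k] b + 1 := by
      intro k
      induction k with
      | zero => rfl
      | succ k ih =>
        rw [Function.iterate_succ_apply', Function.iterate_succ_apply', ih]
        have hp := Pinvn k b hb
        have hns := noS _ hp
        have hle := hbmax _ hp
        have hp2 := ((memP _).1 hp).1
        rw [memW] at hns
        have he : d (g^[k] b) = d (g^[k] b - 1) := by
          by_contra hne
          exact hns ⟨⟨by omega, by omega⟩, hne⟩
        have e1 : g (g^[k] b + 1) = (g^[k] b + 1) + d (g^[k] b + 1 - 1) := rfl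
        have e2 : g (g^[k] b) = g^[k] b + d (g^[k] b - 1) := rfl
        rw [e1, e2, add_sub_cancel_right, he]; ring
    have : b + 1 ∈ Pp := (memP _).2 ⟨⟨by omega, by omega⟩, N, hN, by rw [tr, hbN]⟩
    have := hbmax _ this
    omega
  · have hp := Pinvn (N - 1) b hb
    have hp2 := ((memP _).1 hp).1
    have : g (g^[N - 1] b) = M := by
      have h := Function.iterate_succ_apply' g (N - 1) b
      rw [Nat.succ_eq_add_one, Nat.sub_add_cancel hN, hbN] at h
      rw [← h, heq]
    exact noS _ hp ((up _ hp2.1 hp2.2).2 this)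

/-- T-lemma: the mirror image. -/
theorem shift_aux' (m : ℤ) (d : ℤ → ℤ) (S : ℤ → Prop) (hm : 0 < m)
    (hS : ∀ x, S x → 0 ≤ x)
    (h0 : 0 < d 0) (h1 : d (m - 1) < 0)
    (hhi : ∀ y, 1 ≤ y → y ≤ m - 1 → d y ≠ d (y - 1) → y + d (y - 1) ≤ m)
    (hsw : ∀ y, 1 ≤ y → y ≤ m - 1 → d y ≠ d (y - 1) → S (y + d y) ∧ ¬ S y)
    (hcl : ∀ x, 0 ≤ x → x ≤ m - 1 → S x → S (x + d x)) : False := by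
  refine shift_aux m (fun e => - d (m - 1 - e)) (fun x => S (m - x)) hm ?_ ?_ ?_ ?_ ?_ ?_
  · intro x hx; have := hS _ hx; omega
  · simp only [sub_zero]; omega
  · simp only [sub_self]; omega
  · intro y h1 h2 h3
    have e1 : m - 1 - (y - 1) = m - y := by ring
    have e2 : m - 1 - y = m - y - 1 := by ring
    simp only [e1, e2] at h3 ⊢
    have := hhi (m - y) (by omega) (by omega) (by intro h; apply h3; rw [h])
    omega
  · intro y h1 h2 h3
    have e1 : m - 1 - (y - 1) = m - y := by ring
    have e2 : m - 1 - y = m - y - 1 := by ring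
    simp only [e1, e2] at h3 ⊢
    have := hsw (m - y) (by omega) (by omega) (by intro h; apply h3; rw [h])
    have e3 : m - (y + -d (m - y)) = m - y + d (m - y) := by ring
    rw [e3]; exact this
  · intro x h1 h2 h3
    have e1 : m - 1 - (x - 1) = m - x := by ring
    simp only [e1]
    have := hcl (m - x) (by omega) (by omega) h3
    have e3 : m - (x + -d (m - x)) = m - x + d (m - x) := by ring
    rw [e3]; exact this



abbrev Cp (n : ℕ) : Type := (Bool × ZMod n) ⊕ Bool

/-- Numerical configuration of a bike. -/
structure Cfg (n : ℕ) where
  m : ℕ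
  FL : Set ℕ
  TL : Set ℕ
  cT : Bool → ZMod n → ℕ
  cF : Bool → ZMod n → ℕ
  iB : Bool → ZMod n
  jB : Bool → ZMod n
  f1 : ℕ
  f2 : ℕ
  t1 : ℕ
  bx : ℕ
  tt : ℕ
  tn : ℕ
  cn : ℕ
  hFm : ∀ x ∈ FL, x ≤ m
  hTm : ∀ x ∈ TL, x ≤ m
  hdis : ∀ x ∈ FL, x ∉ TL
  f1F : f1 ∈ FL
  f2F : f2 ∈ FL
  f12 : f1 < f2
  fmin : ∀ x ∈ FL, x = f1 ∨ f2 ≤ x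
  t1T : t1 ∈ TL
  tmin : ∀ x ∈ TL, t1 ≤ x
  t1f1 : t1 < f1
  bxT : bx ∈ TL
  bxf : bx < f1
  bxmax : ∀ x ∈ TL, x < f1 → x ≤ bx
  t1tt : t1 < tt
  ttT : tt ∈ TL
  hcT : ∀ w j, cT w j ∈ TL
  hcF : ∀ w j, cF w j ∈ FL
  cond1 : ∀ w j, cT w j < cF w j
  cond2 : ∀ w j, cT w (j + 1) < cF w j
  hij : ∀ w, iB w ≠ jB w
  nei : ∀ w (l : ℕ), 1 ≤ l → l ≤ m → iB w + l ≠ iB w ∧ iB w + l ≠ jB w ∧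
    iB w - l ≠ iB w ∧ iB w - l ≠ jB w
  nej : ∀ w (l : ℕ), 1 ≤ l → l ≤ m → jB w + l ≠ iB w ∧ jB w + l ≠ jB w ∧
    jB w - l ≠ iB w ∧ jB w - l ≠ jB w
  -- the two shapes of `q`
  shape : ((∀ x ∈ TL, x ≤ bx) ∧ tt = bx ∧ cF true (jB true) = f2 ∧
      ∃ tl ∈ TL, tl < bx ∧ (∀ x ∈ TL, x < bx → x ≤ tl) ∧
        ((cF false (jB false) = f1 ∧ bx + bx ≠ f1 + tl) ∨
         (cF false (jB false) = f2 ∧ bx + bx = f1 + tl))) ∨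
    (f1 < tt ∧ (∀ x ∈ TL, f1 < x → tt ≤ x) ∧ cF true (jB true) = f1 ∧
      cF false (jB false) = f1)
  cTj1 : cT true (jB true) = bx
  cTj0 : cT false (jB false) = t1
  cj : ∀ w (l : ℕ), 1 ≤ l → l ≤ m → cT w (jB w + l) = t1 ∧ cF w (jB w + l) = f1 ∧
    cT w (jB w - l) = t1 ∧ cF w (jB w - l) = f1
  ci : ∀ w, cT w (iB w) = t1 ∧ cF w (iB w) = f2
  cim : ∀ w (l : ℕ), 1 ≤ l → l ≤ m → cT w (iB w - l) = t1 ∧ cF w (iB w - l) = f1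
  cip : ∀ w (l : ℕ), 1 ≤ l → l ≤ m → cT w (iB w + l) = tn ∧ cF w (iB w + l) = cn
  shape2 : (tn = t1 ∧ cn = f1 ∧ f2 + t1 < f1 + f1) ∨
    (tn = bx ∧ cn = f2 ∧ f1 + f1 ≤ f2 + t1 ∧ t1 < bx ∧ (∀ x ∈ TL, x ≤ bx)) ∨
    (tn = bx ∧ cn = f1 ∧ f1 < tt ∧ (∀ x ∈ TL, f1 < x → tt ≤ x))

/-- Position `p` of copy `C` is (glued to) the contact `κ`. -/
def Cfg.On {n : ℕ} (c : Cfg n) : Cp n → ℕ → Bool × ZMod n → Prop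
  | .inl (w, k), p, κ => κ.1 = w ∧ ((p = c.cF w k ∧ κ.2 = k) ∨ (p = c.cT w k ∧ κ.2 = k - 1))
  | .inr false, p, κ => (p = c.f1 ∧ κ = (true, c.iB true)) ∨ (p = c.f2 ∧ κ = (false, c.iB false))
  | .inr true, p, κ => (p = c.t1 ∧ κ = (true, c.jB true)) ∨ (p = c.tt ∧ κ = (false, c.jB false))

/-- A walk through the copies, labelled as `q`. -/
structure Wk {n : ℕ} (c : Cfg n) where
  K : ℕ → Cp n
  P : ℕ → ℕ
  col : Bool → Bool
  hcol : col true ≠ col false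
  hP : ∀ e, e < c.m → P e < c.m
  nF : ∀ e, e < c.m → K e = .inr false → P e < c.f2
  nT : ∀ e, e < c.m → K e = .inr true → c.t1 ≤ P e
  step : ∀ e, e + 1 < c.m → (K (e + 1) = K e ∧ P (e + 1) = P e + 1) ∨
    ∃ κ, c.On (K e) (P e + 1) κ ∧ c.On (K (e + 1)) (P (e + 1)) κ
  F0 : ∀ e, e < c.m → e ∈ c.FL → (∀ κ, c.On (K e) (P e) κ → col κ.1 = true) ∧
    ((∀ κ, ¬ c.On (K e) (P e) κ) → P e ∈ c.FL)
  F1 : ∀ e, e < c.m → e + 1 ∈ c.FL → (∀ κ, c.On (K e) (P e + 1) κ → col κ.1 = true) ∧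
    ((∀ κ, ¬ c.On (K e) (P e + 1) κ) → P e + 1 ∈ c.FL)
  T0 : ∀ e, e < c.m → e ∈ c.TL → (∀ κ, c.On (K e) (P e) κ → col κ.1 = false) ∧
    ((∀ κ, ¬ c.On (K e) (P e) κ) → P e ∈ c.TL)
  T1 : ∀ e, e < c.m → e + 1 ∈ c.TL → (∀ κ, c.On (K e) (P e + 1) κ → col κ.1 = false) ∧
    ((∀ κ, ¬ c.On (K e) (P e + 1) κ) → P e + 1 ∈ c.TL)

namespace Wk
variable {n : ℕ} {c : Cfg n} (h : Wk c)

theorem onW {w : Bool} {k : ZMod n} {p : ℕ} {κ : Bool × ZMod n} :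
    c.On (.inl (w, k)) p κ ↔ κ.1 = w ∧ ((p = c.cF w k ∧ κ.2 = k) ∨ (p = c.cT w k ∧ κ.2 = k - 1)) :=
  Iff.rfl

theorem onQF {p : ℕ} {κ : Bool × ZMod n} :
    c.On (.inr false) p κ ↔
      (p = c.f1 ∧ κ = (true, c.iB true)) ∨ (p = c.f2 ∧ κ = (false, c.iB false)) := Iff.rfl

theorem onQT {p : ℕ} {κ : Bool × ZMod n} :
    c.On (.inr true) p κ ↔
      (p = c.t1 ∧ κ = (true, c.jB true)) ∨ (p = c.tt ∧ κ = (false, c.jB false)) := Iff.rfl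

/-- Members of a contact. -/
theorem on_cases {C : Cp n} {p : ℕ} {w : Bool} {k : ZMod n} (hh : c.On C p (w, k)) :
    (C = .inl (w, k) ∧ p = c.cF w k) ∨ (C = .inl (w, k + 1) ∧ p = c.cT w (k + 1)) ∨
    (C = .inr false ∧ k = c.iB w ∧ ((w = true ∧ p = c.f1) ∨ (w = false ∧ p = c.f2))) ∨
    (C = .inr true ∧ k = c.jB w ∧ ((w = true ∧ p = c.t1) ∨ (w = false ∧ p = c.tt))) := by
  rcases C with ⟨w', k'⟩ | b
  · obtain ⟨h1, h2⟩ := onW.1 hh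
    simp only at h1 h2
    subst h1
    rcases h2 with ⟨h3, rfl⟩ | ⟨h3, rfl⟩
    · left; exact ⟨rfl, h3⟩
    · right; left; simp [h3]
  · cases b
    · rcases onQF.1 hh with ⟨h1, h2⟩ | ⟨h1, h2⟩ <;>
      · simp only [Prod.mk.injEq] at h2
        obtain ⟨rfl, rfl⟩ := h2
        simp [h1]
    · rcases onQT.1 hh with ⟨h1, h2⟩ | ⟨h1, h2⟩ <;>
      · simp only [Prod.mk.injEq] at h2
        obtain ⟨rfl, rfl⟩ := h2
        simp [h1]

/-- Within a contact-free stretch of a copy the walk runs straight. -/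
theorem run {x : ℕ} {C : Cp n} (a b : ℕ) (hx : x < c.m) (hK : h.K x = C)
    (hno : ∀ p κ, a < p → p < b → ¬ c.On C p κ) (ha : a ≤ h.P x) (hb : h.P x < b)
    (y : ℕ) (hy : y < c.m) (hya : a + x ≤ h.P x + y) (hyb : h.P x + y < b + x) :
    h.K y = C ∧ h.P y + x = h.P x + y := by
  have fw : ∀ i, x + i < c.m → h.P x + i < b → h.K (x + i) = C ∧ h.P (x + i) = h.P x + i := by
    intro i
    induction i with
    | zero => intro _ _; exact ⟨hK, rfl⟩
    | succ i ih =>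
      intro h1 h2
      obtain ⟨h3, h4⟩ := ih (by omega) (by omega)
      rcases h.step (x + i) (by omega) with ⟨h5, h6⟩ | ⟨κ, h5, h6⟩
      · exact ⟨by rw [← add_assoc, h5, h3], by rw [← add_assoc, h6, h4]; omega⟩
      · rw [h3] at h5
        exact absurd h5 (hno _ _ (by omega) (by omega))
  have bw : ∀ i, i ≤ x → a + i ≤ h.P x → h.K (x - i) = C ∧ h.P (x - i) + i = h.P x := by
    intro i
    induction i with
    | zero => intro _ _; exact ⟨hK, rfl⟩
    | succ i ih =>
      intro h1 h2
      obtain ⟨h3, h4⟩ := ih (by omega) (by omega)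
      have e : x - (i + 1) + 1 = x - i := by omega
      rcases h.step (x - (i + 1)) (by omega) with ⟨h5, h6⟩ | ⟨κ, h5, h6⟩
      · rw [e] at h5 h6
        exact ⟨by rw [← h5, h3], by omega⟩
      · rw [e, h3] at h6
        exact absurd h6 (hno _ _ (by omega) (by omega))
  rcases le_total x y with hxy | hxy
  · obtain ⟨h1, h2⟩ := fw (y - x) (by omega) (by omega)
    rw [show x + (y - x) = y by omega] at h1 h2
    exact ⟨h1, by omega⟩
  · obtain ⟨h1, h2⟩ := bw (x - y) (by omega) (by omega)
    rw [show x - (x - y) = y by omega] at h1 h2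
    exact ⟨h1, by omega⟩

/-- With no contacts ahead in the copy, the drift is nonpositive. -/
theorem stay {x : ℕ} {C : Cp n} (hx : x < c.m) (hK : h.K x = C)
    (hno : ∀ p κ, h.P x < p → ¬ c.On C p κ) : h.P x ≤ x := by
  obtain ⟨h1, h2⟩ := h.run (h.P x) (h.P x + c.m + 1) hx hK (fun p κ h1 _ => hno p κ h1)
    (le_refl _) (by omega) (c.m - 1) (by omega) (by omega) (by omega)
  have := h.hP (c.m - 1) (by omega)
  omega

/-- With no contacts behind in the copy, the drift is nonnegative. -/
theorem start {x : ℕ} {C : Cp n} (hx : x < c.m) (hK : h.K x = C)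
    (hno : ∀ p κ, p ≤ h.P x → ¬ c.On C p κ) : x ≤ h.P x := by
  by_contra hlt
  obtain ⟨h1, h2⟩ := h.run 0 (h.P x + 1) hx hK (fun p κ _ h1 => hno p κ (by omega))
    (by omega) (by omega) (x - h.P x) (by omega) (by omega) (by omega)
  have e : x - h.P x - 1 + 1 = x - h.P x := by omega
  rcases h.step (x - h.P x - 1) (by omega) with ⟨h5, h6⟩ | ⟨κ, h5, h6⟩
  · rw [e] at h6; omega
  · rw [e, h1] at h6
    exact hno _ _ (by omega) h6

theorem stayW {x : ℕ} {w : Bool} {k : ZMod n} (hx : x < c.m) (hK : h.K x = .inl (w, k))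
    (hp : c.cF w k ≤ h.P x) : h.P x ≤ x := by
  refine h.stay hx hK ?_
  intro p κ h1 h2
  have := c.cond1 w k
  rcases (onW.1 h2).2 with ⟨h3, _⟩ | ⟨h3, _⟩ <;> omega

theorem startW {x : ℕ} {w : Bool} {k : ZMod n} (hx : x < c.m) (hK : h.K x = .inl (w, k))
    (hp : h.P x < c.cT w k) : x ≤ h.P x := by
  refine h.start hx hK ?_
  intro p κ h1 h2
  have := c.cond1 w k
  rcases (onW.1 h2).2 with ⟨h3, _⟩ | ⟨h3, _⟩ <;> omega

theorem runW {x : ℕ} {w : Bool} {k : ZMod n} (hx : x < c.m) (hK : h.K x = .inl (w, k))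
    (ha : c.cT w k ≤ h.P x) (hb : h.P x < c.cF w k)
    (y : ℕ) (hy : y < c.m) (hya : c.cT w k + x ≤ h.P x + y) (hyb : h.P x + y < c.cF w k + x) :
    h.K y = .inl (w, k) ∧ h.P y + x = h.P x + y := by
  refine h.run (c.cT w k) (c.cF w k) hx hK ?_ ha hb y hy hya hyb
  intro p κ h1 h2 h3
  rcases (onW.1 h3).2 with ⟨h3, _⟩ | ⟨h3, _⟩ <;> omega

theorem F0W {e : ℕ} {w : Bool} {k : ZMod n} (he : e < c.m) (hf : e ∈ c.FL)
    (hK : h.K e = .inl (w, k)) :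
    (h.P e = c.cF w k ∧ h.col w = true) ∨ (h.P e = c.cT w k ∧ h.col w = true) ∨
    (h.P e ≠ c.cF w k ∧ h.P e ≠ c.cT w k ∧ h.P e ∈ c.FL) := by
  obtain ⟨h1, h2⟩ := h.F0 e he hf
  rw [hK] at h1 h2
  by_cases ha : h.P e = c.cF w k
  · left; exact ⟨ha, h1 (w, k) ⟨rfl, Or.inl ⟨ha, rfl⟩⟩⟩
  by_cases hb : h.P e = c.cT w k
  · right; left; exact ⟨hb, h1 (w, k - 1) ⟨rfl, Or.inr ⟨hb, rfl⟩⟩⟩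
  · right; right; refine ⟨ha, hb, h2 ?_⟩
    intro κ h3
    rcases (onW.1 h3).2 with ⟨h3, _⟩ | ⟨h3, _⟩ <;> contradiction

theorem F1W {e : ℕ} {w : Bool} {k : ZMod n} (he : e < c.m) (hf : e + 1 ∈ c.FL)
    (hK : h.K e = .inl (w, k)) :
    (h.P e + 1 = c.cF w k ∧ h.col w = true) ∨ (h.P e + 1 = c.cT w k ∧ h.col w = true) ∨
    (h.P e + 1 ≠ c.cF w k ∧ h.P e + 1 ≠ c.cT w k ∧ h.P e + 1 ∈ c.FL) := by
  obtain ⟨h1, h2⟩ := h.F1 e he hf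
  rw [hK] at h1 h2
  by_cases ha : h.P e + 1 = c.cF w k
  · left; exact ⟨ha, h1 (w, k) ⟨rfl, Or.inl ⟨ha, rfl⟩⟩⟩
  by_cases hb : h.P e + 1 = c.cT w k
  · right; left; exact ⟨hb, h1 (w, k - 1) ⟨rfl, Or.inr ⟨hb, rfl⟩⟩⟩
  · right; right; refine ⟨ha, hb, h2 ?_⟩
    intro κ h3
    rcases (onW.1 h3).2 with ⟨h3, _⟩ | ⟨h3, _⟩ <;> contradiction

theorem T0W {e : ℕ} {w : Bool} {k : ZMod n} (he : e < c.m) (hf : e ∈ c.TL)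
    (hK : h.K e = .inl (w, k)) :
    (h.P e = c.cF w k ∧ h.col w = false) ∨ (h.P e = c.cT w k ∧ h.col w = false) ∨
    (h.P e ≠ c.cF w k ∧ h.P e ≠ c.cT w k ∧ h.P e ∈ c.TL) := by
  obtain ⟨h1, h2⟩ := h.T0 e he hf
  rw [hK] at h1 h2
  by_cases ha : h.P e = c.cF w k
  · left; exact ⟨ha, h1 (w, k) ⟨rfl, Or.inl ⟨ha, rfl⟩⟩⟩
  by_cases hb : h.P e = c.cT w k
  · right; left; exact ⟨hb, h1 (w, k - 1) ⟨rfl, Or.inr ⟨hb, rfl⟩⟩⟩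
  · right; right; refine ⟨ha, hb, h2 ?_⟩
    intro κ h3
    rcases (onW.1 h3).2 with ⟨h3, _⟩ | ⟨h3, _⟩ <;> contradiction

theorem T1W {e : ℕ} {w : Bool} {k : ZMod n} (he : e < c.m) (hf : e + 1 ∈ c.TL)
    (hK : h.K e = .inl (w, k)) :
    (h.P e + 1 = c.cF w k ∧ h.col w = false) ∨ (h.P e + 1 = c.cT w k ∧ h.col w = false) ∨
    (h.P e + 1 ≠ c.cF w k ∧ h.P e + 1 ≠ c.cT w k ∧ h.P e + 1 ∈ c.TL) := by
  obtain ⟨h1, h2⟩ := h.T1 e he hf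
  rw [hK] at h1 h2
  by_cases ha : h.P e + 1 = c.cF w k
  · left; exact ⟨ha, h1 (w, k) ⟨rfl, Or.inl ⟨ha, rfl⟩⟩⟩
  by_cases hb : h.P e + 1 = c.cT w k
  · right; left; exact ⟨hb, h1 (w, k - 1) ⟨rfl, Or.inr ⟨hb, rfl⟩⟩⟩
  · right; right; refine ⟨ha, hb, h2 ?_⟩
    intro κ h3
    rcases (onW.1 h3).2 with ⟨h3, _⟩ | ⟨h3, _⟩ <;> contradiction

/-- Drift zero between the contacts of a wheel copy is impossible. -/
theorem zeroW {x : ℕ} {w : Bool} {k : ZMod n} (hx : x < c.m) (hK : h.K x = .inl (w, k))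
    (ha : c.cT w k ≤ h.P x) (hb : h.P x < c.cF w k) (h0 : h.P x = x) : False := by
  have hm := c.hFm _ (c.hcF w k)
  have h1 := c.cond1 w k
  obtain ⟨h2, h3⟩ := h.runW hx hK ha hb (c.cT w k) (by omega) (by omega) (by omega)
  obtain ⟨h4, h5⟩ := h.runW hx hK ha hb (c.cF w k - 1) (by omega) (by omega) (by omega)
  have e : c.cF w k - 1 + 1 = c.cF w k := by omega
  have h6 := h.T0W (by omega) (c.hcT w k) h2
  have h7 := h.F1W (e := c.cF w k - 1) (by omega) (by rw [e]; exact c.hcF w k) h4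
  have h8 : h.col w = false := by
    rcases h6 with h | h | h
    · exact h.2
    · exact h.2
    · omega
  have h9 : h.col w = true := by
    rcases h7 with h | h | h
    · exact h.2
    · exact h.2
    · omega
  rw [h8] at h9
  exact absurd h9 (by decide)

/-- One step out of a wheel copy. -/
theorem stepW {y : ℕ} {w : Bool} {k : ZMod n} (hy : y + 1 < c.m) (hK : h.K y = .inl (w, k)) :
    (h.K (y + 1) = .inl (w, k) ∧ h.P (y + 1) = h.P y + 1) ∨
    (h.P y + 1 = c.cF w k ∧ c.On (h.K (y + 1)) (h.P (y + 1)) (w, k)) ∨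
    (h.P y + 1 = c.cT w k ∧ c.On (h.K (y + 1)) (h.P (y + 1)) (w, k - 1)) := by
  rcases h.step y hy with ⟨h1, h2⟩ | ⟨κ, h1, h2⟩
  · left; exact ⟨by rw [h1, hK], h2⟩
  · rw [hK] at h1
    obtain ⟨w', k'⟩ := κ
    obtain ⟨h3, h4⟩ := onW.1 h1
    simp only at h3 h4
    subst h3
    rcases h4 with ⟨h4, rfl⟩ | ⟨h4, rfl⟩
    · right; left; exact ⟨h4, h2⟩
    · right; right; exact ⟨h4, h2⟩

/-- One step into a wheel copy. -/
theorem backW {y : ℕ} {w : Bool} {k : ZMod n} (hy : y + 1 < c.m) (hK : h.K (y + 1) = .inl (w, k)) :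
    (h.K y = .inl (w, k) ∧ h.P (y + 1) = h.P y + 1) ∨
    (h.P (y + 1) = c.cF w k ∧ c.On (h.K y) (h.P y + 1) (w, k)) ∨
    (h.P (y + 1) = c.cT w k ∧ c.On (h.K y) (h.P y + 1) (w, k - 1)) := by
  rcases h.step y hy with ⟨h1, h2⟩ | ⟨κ, h1, h2⟩
  · left; exact ⟨by rw [← h1, hK], h2⟩
  · rw [hK] at h2
    obtain ⟨w', k'⟩ := κ
    obtain ⟨h3, h4⟩ := onW.1 h2
    simp only at h3 h4
    subst h3
    rcases h4 with ⟨h4, rfl⟩ | ⟨h4, rfl⟩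
    · right; left; exact ⟨h4, h1⟩
    · right; right; exact ⟨h4, h1⟩

end Wk

namespace Wk
variable {n : ℕ} {c : Cfg n} (h : Wk c)

/-- Forward motion through a connection-free stretch of a wheel. -/
theorem fwd {w : Bool} {k0 : ZMod n} {x : ℕ}
    (hne : ∀ l : ℕ, 1 ≤ l → l ≤ c.m → k0 + l ≠ c.iB w ∧ k0 + l ≠ c.jB w)
    (hK : h.K x = .inl (w, k0 + 1)) (hPx : h.P x = c.cT w (k0 + 1)) :
    ∀ i, x + i < c.m → (∃ l : ℕ, 1 ≤ l ∧ l ≤ i + 1 ∧ h.K (x + i) = .inl (w, k0 + l) ∧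
      ∃ x', x' ≤ x + i ∧ h.K x' = .inl (w, k0 + l) ∧ h.P x' = c.cT w (k0 + l) ∧
        h.P (x + i) + x' = c.cT w (k0 + l) + (x + i)) ∧
      ∀ z, x ≤ z → z ≤ x + i → h.P (x + i) + z ≤ h.P z + (x + i) := by
  intro i
  induction i with
  | zero =>
    intro hx
    refine ⟨⟨1, le_refl _, le_refl _, by simpa using hK, x, le_refl _, by simpa using hK,
      by simpa using hPx, by simp [hPx]⟩, ?_⟩
    intro z h1 h2
    have : z = x := by omega
    subst this; simp
  | succ i ih =>
    intro hx
    obtain ⟨⟨l, hl1, hl2, hKy, x', hx', hKx', hPx', hPy⟩, hmono⟩ := ih (by omega)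
    have hx2 : x + i + 1 < c.m := by omega
    have e : x + (i + 1) = x + i + 1 := by ring
    rw [e]
    have fin : (∃ l : ℕ, 1 ≤ l ∧ l ≤ i + 1 + 1 ∧ h.K (x + i + 1) = .inl (w, k0 + l) ∧
      ∃ x', x' ≤ x + i + 1 ∧ h.K x' = .inl (w, k0 + l) ∧ h.P x' = c.cT w (k0 + l) ∧
        h.P (x + i + 1) + x' = c.cT w (k0 + l) + (x + i + 1)) ∧
        h.P (x + i + 1) ≤ h.P (x + i) + 1 := by
      have strt : h.K (x + i + 1) = .inl (w, k0 + l) → h.P (x + i + 1) = h.P (x + i) + 1 → 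
        (∃ l : ℕ, 1 ≤ l ∧ l ≤ i + 1 + 1 ∧ h.K (x + i + 1) = .inl (w, k0 + l) ∧
      ∃ x', x' ≤ x + i + 1 ∧ h.K x' = .inl (w, k0 + l) ∧ h.P x' = c.cT w (k0 + l) ∧
        h.P (x + i + 1) + x' = c.cT w (k0 + l) + (x + i + 1)) ∧
        h.P (x + i + 1) ≤ h.P (x + i) + 1 := by
        intro h1 h2
        exact ⟨⟨l, hl1, by omega, h1, x', by omega, hKx', hPx', by omega⟩, by omega⟩
      rcases h.stepW hx2 hKy with ⟨h1, h2⟩ | ⟨h1, h2⟩ | ⟨h1, h2⟩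
      · exact strt h1 h2
      · have hn := hne l hl1 (by omega)
        rcases on_cases h2 with ⟨h3, h4⟩ | ⟨h3, h4⟩ | ⟨h3, h4, h5⟩ | ⟨h3, h4, h5⟩
        · exact strt h3 (by omega)
        · have e2 : k0 + (l : ZMod n) + 1 = k0 + ((l + 1 : ℕ) : ZMod n) := by push_cast; ring
          have c2 := c.cond2 w (k0 + l)
          refine ⟨⟨l + 1, by omega, by omega, ?_, x + i + 1, le_refl _, ?_, ?_, ?_⟩, by omega⟩
          · rw [h3, e2]
          · rw [h3, e2]
          · rw [h4, e2]
          · rw [h4, e2]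
        · exact absurd h4 hn.1
        · exact absurd h4 hn.2
      · omega
    refine ⟨fin.1, ?_⟩
    intro z h1 h2
    rcases Nat.lt_or_ge (x + i) z with h3 | h3
    · have : z = x + i + 1 := by omega
      subst this; simp
    · have := hmono z h1 h3
      have := fin.2
      omega

theorem lemS {w : Bool} {x : ℕ} (hK : h.K x = .inl (w, c.iB w + 1)) (hPx : h.P x = c.tn)
    (hx : x ≤ c.f1) : False := by
  have hf2 := c.hFm _ c.f2F
  have hf12 := c.f12
  have htt := c.hTm _ c.ttT
  have hm1 : (1 : ℕ) ≤ c.m := by omega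
  have ec := c.cip w 1 (le_refl _) hm1
  have hne : ∀ l : ℕ, 1 ≤ l → l ≤ c.m → c.iB w + l ≠ c.iB w ∧ c.iB w + l ≠ c.jB w :=
    fun l h1 h2 => ⟨(c.nei w l h1 h2).1, (c.nei w l h1 h2).2.1⟩
  have F := h.fwd hne hK (by rw [hPx]; simpa using ec.1.symm)
  obtain ⟨⟨l, hl1, hl2, hKy, x', hx', hKx', hPx', hPy⟩, -⟩ := F (c.f1 - x) (by omega)
  have e : x + (c.f1 - x) = c.f1 := by omega
  rw [e] at hKy hx' hPy
  obtain ⟨et, ef⟩ := c.cip w l hl1 (by omega)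
  have c1 := c.cond1 w (c.iB w + l)
  have D0 : h.P c.f1 = c.f1 → False := by
    intro h1
    exact h.zeroW (x := x') (by omega) hKx' (by omega) (by omega) (by omega)
  have ST : c.cF w (c.iB w + l) ≤ h.P c.f1 → h.P c.f1 ≤ c.f1 := h.stayW (by omega) hKy
  have h0 := h.F0W (by omega) c.f1F hKy
  have h1 : h.P c.f1 = c.cT w (c.iB w + l) → h.col w = true → False := by
    intro h1 hc
    have R2 : c.cT w (c.iB w + l) + c.f2 ≤ c.cF w (c.iB w + l) + c.f1 → c.f2 - 1 < c.m →
        h.K (c.f2 - 1) = .inl (w, c.iB w + l) ∧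
        h.P (c.f2 - 1) + c.f1 = h.P c.f1 + (c.f2 - 1) := fun hh hm =>
      h.runW (x := c.f1) (by omega) hKy (by omega) (by omega) (c.f2 - 1) hm (by omega) (by omega)
    have e2 : c.f2 - 1 + 1 = c.f2 := by omega
    rcases c.shape2 with ⟨a1, a2, a3⟩ | ⟨a1, a2, a3, a4, a5⟩ | ⟨a1, a2, a3, a4⟩
    · have := R2 (by omega) (by omega)
      have h3 := h.F1W (e := c.f2 - 1) (by omega) (by rw [e2]; exact c.f2F) this.1
      rcases h3 with h3 | h3 | h3
      · omega
      · omega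
      · have := c.fmin _ h3.2.2
        omega
    · have hb := c.bxf
      have := R2 (by omega) (by omega)
      have h3 := h.F1W (e := c.f2 - 1) (by omega) (by rw [e2]; exact c.f2F) this.1
      rcases h3 with h3 | h3 | h3
      · omega
      · omega
      · have := c.fmin _ h3.2.2
        omega
    · have hb := c.bxf
      obtain ⟨⟨l', hl1', hl2', hKy', x'', hx'', hKx'', hPx'', hPy'⟩, hmono⟩ := F (c.tt - 1 - x) (by omega)
      have hmo := hmono c.f1 hx (by omega)
      have e3 : x + (c.tt - 1 - x) = c.tt - 1 := by omega
      have e4 : c.tt - 1 + 1 = c.tt := by omega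
      rw [e3] at hKy' hx'' hPy' hmo
      obtain ⟨et', ef'⟩ := c.cip w l' hl1' (by omega)
      have h3 := h.T1W (e := c.tt - 1) (by omega) (by rw [e4]; exact c.ttT) hKy'
      rcases h3 with h3 | h3 | h3
      · rw [hc] at h3; exact absurd h3.2 (by decide)
      · rw [hc] at h3; exact absurd h3.2 (by decide)
      · have b1 := c.bxmax _ h3.2.2
        have b2 := a4 _ h3.2.2
        omega
  rcases h0 with h0 | h0 | h0
  · rcases c.shape2 with ⟨a1, a2, a3⟩ | ⟨a1, a2, a3, a4, a5⟩ | ⟨a1, a2, a3, a4⟩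
    · exact D0 (by omega)
    · have := ST (by omega); omega
    · exact D0 (by omega)
  · exact h1 h0.1 h0.2
  · rcases c.fmin _ h0.2.2 with h2 | h2
    · exact D0 h2
    · have : c.cn ≤ c.f2 := by
        rcases c.shape2 with ⟨a1, a2, a3⟩ | ⟨a1, a2, a3, a4, a5⟩ | ⟨a1, a2, a3, a4⟩ <;> omega
      have := ST (by omega); omega

theorem lemS' {w : Bool} {x : ℕ} (hK : h.K x = .inl (w, c.jB w + 1)) (hPx : h.P x = c.t1)
    (hx : x < c.f1) : False := by
  have hf2 := c.hFm _ c.f2F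
  have hf12 := c.f12
  have hm1 : (1 : ℕ) ≤ c.m := by omega
  have ec := c.cj w 1 (le_refl _) hm1
  have hne : ∀ l : ℕ, 1 ≤ l → l ≤ c.m → c.jB w + l ≠ c.iB w ∧ c.jB w + l ≠ c.jB w :=
    fun l h1 h2 => ⟨(c.nej w l h1 h2).1, (c.nej w l h1 h2).2.1⟩
  have F := h.fwd hne hK (by rw [hPx]; simpa using ec.1.symm)
  obtain ⟨⟨l, hl1, hl2, hKy, x', hx', hKx', hPx', hPy⟩, -⟩ := F (c.f1 - 1 - x) (by omega)
  have e : x + (c.f1 - 1 - x) = c.f1 - 1 := by omega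
  have e2 : c.f1 - 1 + 1 = c.f1 := by omega
  rw [e] at hKy hx' hPy
  obtain ⟨et, ef, -, -⟩ := c.cj w l hl1 (by omega)
  have c1 := c.cond1 w (c.jB w + l)
  rcases h.F1W (e := c.f1 - 1) (by omega) (by rw [e2]; exact c.f1F) hKy with h0 | h0 | h0
  · exact h.zeroW (x := x') (by omega) hKx' (by omega) (by omega) (by omega)
  · omega
  · have := c.fmin _ h0.2.2
    have := h.stayW (x := c.f1 - 1) (by omega) hKy (by omega)
    omega

theorem lemB {w : Bool} {k0 : ZMod n} {s : ℕ} (hs : s < c.m)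
    (hk : ∀ l : ℕ, 1 ≤ l → l ≤ c.m → c.cT w (k0 - l) = c.t1 ∧ c.cF w (k0 - l) = c.f1 ∧
      k0 - l ≠ c.iB w ∧ k0 - l ≠ c.jB w)
    (hct : c.cT w k0 < c.f1)
    (hK : h.K s = .inl (w, k0)) (hPs : h.P s + 1 = c.cF w k0)
    (hcf : (c.cF w k0 = c.f1 ∧ c.f1 ≤ s + 1) ∨ (c.cF w k0 = c.f2 ∧ c.f1 ≤ s)) : False := by
  have hf12 := c.f12
  have ht1 := c.t1f1
  have bwd : ∀ i, i ≤ s → ∃ l : ℕ, l ≤ i ∧ h.K (s - i) = .inl (w, k0 - l) ∧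
      h.P (s - i) < c.cF w (k0 - l) ∧ (l = 0 → h.P (s - i) + i = h.P s) := by
    intro i
    induction i with
    | zero => intro _; exact ⟨0, le_refl _, by simpa using hK, by simp; omega, by simp⟩
    | succ i ih =>
      intro hi
      obtain ⟨l, hl, h1, h2, h3⟩ := ih (by omega)
      have e : s - (i + 1) + 1 = s - i := by omega
      rw [← e] at h1
      have hb := h.backW (by omega) h1
      rw [e] at hb
      rcases hb with ⟨h4, h5⟩ | ⟨h4, h5⟩ | ⟨h4, h5⟩
      · exact ⟨l, by omega, h4, by omega, by omega⟩
      · omega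
      · have e2 : k0 - (l : ZMod n) - 1 = k0 - ((l + 1 : ℕ) : ZMod n) := by push_cast; ring
        have e3 : k0 - (l : ZMod n) - 1 + 1 = k0 - (l : ZMod n) := by ring
        obtain ⟨-, -, hn1, hn2⟩ := hk (l + 1) (by omega) (by omega)
        rcases on_cases h5 with ⟨h6, h7⟩ | ⟨h6, h7⟩ | ⟨h6, h7, h8⟩ | ⟨h6, h7, h8⟩
        · rw [e2] at h6 h7
          exact ⟨l + 1, by omega, h6, by omega, by omega⟩
        · rw [e3] at h6 h7
          exact ⟨l, by omega, h6, by omega, by omega⟩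
        · rw [e2] at h7; exact absurd h7 hn1
        · rw [e2] at h7; exact absurd h7 hn2
  obtain ⟨l, hl, h1, h2, h3⟩ := bwd (s - (c.f1 - 1)) (by omega)
  have e : s - (s - (c.f1 - 1)) = c.f1 - 1 := by omega
  have e2 : c.f1 - 1 + 1 = c.f1 := by omega
  rw [e] at h1 h2 h3
  have hlt : c.cT w (k0 - l) < c.f1 := by
    rcases Nat.eq_zero_or_pos l with rfl | hp
    · simpa using hct
    · rw [(hk l hp (by omega)).1]; omega
  have hff : (c.cF w (k0 - l) = c.f1) ∨ (c.cF w (k0 - l) = c.f2 ∧ l = 0 ∧ c.f1 ≤ s) := by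
    rcases Nat.eq_zero_or_pos l with rfl | hp
    · simp; omega
    · left; exact (hk l hp (by omega)).2.1
  rcases h.F1W (e := c.f1 - 1) (by omega) (by rw [e2]; exact c.f1F) h1 with h0 | h0 | h0
  · rcases hff with h4 | ⟨h4, h5, h6⟩
    · exact h.zeroW (x := c.f1 - 1) (by omega) h1 (by omega) (by omega) (by omega)
    · subst h5; simp at h4; have := h3 rfl; simp at h0; omega
  · have := h.startW (x := c.f1 - 1) (by omega) h1 (by omega)
    omega
  · rcases c.fmin _ h0.2.2 with h4 | h4
    · exact h.zeroW (x := c.f1 - 1) (by omega) h1 (by omega) (by omega) (by omega)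
    · omega

end Wk

namespace Wk
variable {n : ℕ} {c : Cfg n} (h : Wk c)

theorem tn_lt : c.tn < c.f1 := by
  have := c.bxf
  have := c.t1f1
  rcases c.shape2 with ⟨a1, a2, a3⟩ | ⟨a1, a2, a3, a4, a5⟩ | ⟨a1, a2, a3, a4⟩ <;> omega

theorem f1_pos : 0 < c.f1 := by have := c.t1f1; omega

theorem cip1 (hm : 1 ≤ c.m) (w : Bool) : c.cT w (c.iB w + 1) = c.tn ∧ c.cF w (c.iB w + 1) = c.cn := by
  simpa using c.cip w 1 (le_refl _) hm

theorem cj1 (hm : 1 ≤ c.m) (w : Bool) : c.cT w (c.jB w + 1) = c.t1 ∧ c.cF w (c.jB w + 1) = c.f1 := by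
  have := c.cj w 1 (le_refl _) hm
  simp only [Nat.cast_one] at this
  exact ⟨this.1, this.2.1⟩

theorem noF_high {x : ℕ} (hx : x < c.m) (hK : h.K x = .inr false) (ha : c.f1 ≤ h.P x) : False := by
  have hb := h.nF x hx hK
  have hf2 := c.hFm _ c.f2F
  have hf12 := c.f12
  have htn := tn_lt (c := c)
  have hf1 := f1_pos (c := c)
  have hno : ∀ p κ, c.f1 < p → p < c.f2 → ¬ c.On (.inr false) p κ := by
    intro p κ h1 h2 h3
    rcases onQF.1 h3 with h4 | h4 <;> omega
  have R := h.run c.f1 c.f2 hx hK hno ha hb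
  rcases lt_trichotomy (h.P x) x with hlt | heq | hgt
  · obtain ⟨h1, h2⟩ := R (c.f1 + x - h.P x) (by omega) (by omega) (by omega)
    set s := c.f1 + x - h.P x - 1 with hs
    have e : c.f1 + x - h.P x = s + 1 := by omega
    rw [e] at h1 h2
    have hlow : h.K s = .inr false → h.P s + 1 = c.f1 → False := by
      intro h3 h4
      have := h.start (x := s) (by omega) h3 (by
        intro p κ h5 h6
        rcases onQF.1 h6 with h4 | h4 <;> omega)
      omega
    rcases h.step s (by omega) with ⟨h3, h4⟩ | ⟨κ, h3, h4⟩
    · exact hlow (by rw [← h3, h1]) (by omega)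
    · rw [h1] at h4
      have hκ : κ = (true, c.iB true) := by
        rcases onQF.1 h4 with h5 | h5
        · exact h5.2
        · omega
      subst hκ
      rcases on_cases h3 with ⟨h6, h7⟩ | ⟨h6, h7⟩ | ⟨h6, h7, h8⟩ | ⟨h6, h7, h8⟩
      · have hci := c.ci true
        have := c.t1f1
        refine h.lemB (s := s) (by omega) ?_ (by omega) h6 h7 (by omega)
        intro l h8 h9
        exact ⟨(c.cim true l h8 h9).1, (c.cim true l h8 h9).2, (c.nei true l h8 h9).2.2⟩
      · rw [(cip1 (by omega) true).1] at h7
        have := h.startW (x := s) (by omega) h6 (by rw [(cip1 (by omega) true).1]; omega)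
        omega
      · rcases h8 with h8 | h8
        · exact hlow h6 h8.2
        · exact absurd h8.1 (by decide)
      · exact c.hij _ h7
  · obtain ⟨h1, h2⟩ := R c.f1 (by omega) (by omega) (by omega)
    obtain ⟨h3, h4⟩ := R (c.f2 - 1) (by omega) (by omega) (by omega)
    have e : c.f2 - 1 + 1 = c.f2 := by omega
    have h5 := (h.F0 c.f1 (by omega) c.f1F).1 (true, c.iB true)
      (by rw [h1]; left; exact ⟨by omega, rfl⟩)
    have h6 := (h.F1 (c.f2 - 1) (by omega) (by rw [e]; exact c.f2F)).1 (false, c.iB false)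
      (by rw [h3]; right; exact ⟨by omega, rfl⟩)
    exact h.hcol (h5.trans h6.symm)
  · by_cases hc : c.f1 + h.P x < c.f2 + x
    · obtain ⟨h1, h2⟩ := R c.f1 (by omega) (by omega) (by omega)
      have h5 := (h.F0 c.f1 (by omega) c.f1F).2 (by rw [h1]; intro κ; exact hno _ _ (by omega) (by omega))
      have := c.fmin _ h5
      omega
    · set y := x + c.f2 - 1 - h.P x with hy
      obtain ⟨h1, h2⟩ := R y (by omega) (by omega) (by omega)
      rcases h.step y (by omega) with ⟨h3, h4⟩ | ⟨κ, h3, h4⟩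
      · have := h.nF (y + 1) (by omega) (by rw [h3, h1])
        omega
      · rw [h1] at h3
        have hκ : κ = (false, c.iB false) := by
          rcases onQF.1 h3 with h5 | h5
          · omega
          · exact h5.2
        subst hκ
        rcases on_cases h4 with ⟨h6, h7⟩ | ⟨h6, h7⟩ | ⟨h6, h7, h8⟩ | ⟨h6, h7, h8⟩
        · have hci := c.ci false
          have := h.stayW (x := y + 1) (by omega) h6 (by omega)
          omega
        · exact h.lemS h6 (by rw [h7, (cip1 (by omega) false).1]) (by omega)
        · have := h.nF (y + 1) (by omega) h6
          rcases h8 with h8 | h8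
          · exact absurd h8.1 (by decide)
          · omega
        · exact c.hij _ h7

theorem noF {x : ℕ} (hx : x < c.m) (hK : h.K x = .inr false) : False := by
  have hb := h.nF x hx hK
  have hf2 := c.hFm _ c.f2F
  have hf12 := c.f12
  by_cases hc : c.f1 ≤ h.P x
  · exact h.noF_high hx hK hc
  have hno : ∀ p κ, 0 < p → p < c.f1 → ¬ c.On (.inr false) p κ := by
    intro p κ h1 h2 h3
    rcases onQF.1 h3 with h4 | h4 <;> omega
  have hst := h.start hx hK (by
        intro p κ h5 h6
        rcases onQF.1 h6 with h4 | h4 <;> omega)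
  set y := x + c.f1 - 1 - h.P x with hy
  obtain ⟨h1, h2⟩ := h.run 0 c.f1 hx hK hno (by omega) (by omega) y (by omega) (by omega) (by omega)
  rcases h.step y (by omega) with ⟨h3, h4⟩ | ⟨κ, h3, h4⟩
  · exact h.noF_high (x := y + 1) (by omega) (by rw [h3, h1]) (by omega)
  · rw [h1] at h3
    have hκ : κ = (true, c.iB true) := by
      rcases onQF.1 h3 with h5 | h5
      · exact h5.2
      · omega
    subst hκ
    rcases on_cases h4 with ⟨h6, h7⟩ | ⟨h6, h7⟩ | ⟨h6, h7, h8⟩ | ⟨h6, h7, h8⟩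
    · have hci := c.ci true
      have := h.stayW (x := y + 1) (by omega) h6 (by omega)
      omega
    · exact h.lemS h6 (by rw [h7, (cip1 (by omega) true).1]) (by omega)
    · rcases h8 with h8 | h8
      · exact h.noF_high (x := y + 1) (by omega) h6 (by omega)
      · exact absurd h8.1 (by decide)
    · exact c.hij _ h7

theorem F0T {e : ℕ} (he : e < c.m) (hf : e ∈ c.FL) (hK : h.K e = .inr true) :
    h.P e = c.t1 ∨ h.P e = c.tt ∨ h.P e ∈ c.FL := by
  by_cases h1 : h.P e = c.t1
  · exact Or.inl h1
  by_cases h2 : h.P e = c.tt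
  · exact Or.inr (Or.inl h2)
  right; right
  refine (h.F0 e he hf).2 ?_
  intro κ h3
  rw [hK] at h3
  rcases onQT.1 h3 with h4 | h4 <;> omega

theorem T0T {e : ℕ} (he : e < c.m) (hf : e ∈ c.TL) (hK : h.K e = .inr true) :
    h.P e = c.t1 ∨ h.P e = c.tt ∨ h.P e ∈ c.TL := by
  by_cases h1 : h.P e = c.t1
  · exact Or.inl h1
  by_cases h2 : h.P e = c.tt
  · exact Or.inr (Or.inl h2)
  right; right
  refine (h.T0 e he hf).2 ?_
  intro κ h3
  rw [hK] at h3
  rcases onQT.1 h3 with h4 | h4 <;> omega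

theorem f1_lt_m : c.f1 < c.m := by
  have hf2 := c.hFm _ c.f2F
  have hf12 := c.f12
  omega

theorem cjf (w : Bool) : c.f1 ≤ c.cF w (c.jB w) := by
  have := c.f12
  rcases c.fmin _ (c.hcF w (c.jB w)) with h | h <;> omega

theorem hkj (w : Bool) : ∀ l : ℕ, 1 ≤ l → l ≤ c.m → c.cT w (c.jB w - l) = c.t1 ∧ c.cF w (c.jB w - l) = c.f1 ∧
      c.jB w - l ≠ c.iB w ∧ c.jB w - l ≠ c.jB w := by
  intro l h1 h2
  exact ⟨(c.cj w l h1 h2).2.2.1, (c.cj w l h1 h2).2.2.2, (c.nej w l h1 h2).2.2⟩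

theorem lemE {s : ℕ} (hs : s + 1 < c.m) (hK : h.K (s + 1) = .inr true) (hP : h.P (s + 1) = c.tt)
    (hst : c.tt ≤ s + 1) (hK' : h.K s = .inl (false, c.jB false))
    (hP' : h.P s + 1 = c.cF false (c.jB false)) : False := by
  have hf12 := c.f12
  have hfm := f1_lt_m (c := c)
  have ht1 := c.t1f1
  have hb := c.bxf
  have h0 := c.cTj0
  have hB : (c.cF false (c.jB false) = c.f1 ∧ c.f1 ≤ s + 1) ∨
      (c.cF false (c.jB false) = c.f2 ∧ c.f1 ≤ s) → False := fun hh =>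
    h.lemB (by omega) (hkj false) (by omega) hK' hP' hh
  rcases c.shape with ⟨a1, a2, a3, tl, b1, b2, b3, b4⟩ | ⟨a1, a2, a3, a4⟩
  · have htl := c.tmin _ b1
    have R := h.runW (x := s) (by omega) hK' (by have := cjf (c := c) false; omega) (by omega)
    rcases lt_trichotomy c.f1 (s + 1) with hlt | heq | hgt
    · apply hB; omega
    · have hcl := cjf (c := c) false
      rcases b4 with ⟨b4, -⟩ | ⟨b4, -⟩
      · apply hB; omega
      · have hb1 := c.tmin _ c.bxT
        obtain ⟨h1, h2⟩ := R c.bx (by omega) (by omega) (by omega)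
        rcases h.T0W (by omega) c.bxT h1 with h3 | h3 | h3
        · omega
        · omega
        · have := a1 _ h3.2.2
          omega
    · rcases Nat.lt_or_ge c.tt (s + 1) with h1 | h1
      · obtain ⟨h2, h3⟩ := h.run c.tt (c.tt + c.m + 1) hs hK (by
          intro p κ h1 h2 h3
          have := c.t1tt
          rcases onQT.1 h3 with h4 | h4 <;> omega) (by omega) (by omega) c.f1 (by omega) (by omega) (by omega)
        have := c.t1tt
        rcases h.F0T (by omega) c.f1F h2 with h4 | h4 | h4
        · omega
        · omega
        · have := c.fmin _ h4
          omega
      · have hcl := cjf (c := c) false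
        obtain ⟨h2, h3⟩ := R tl (by omega) (by omega) (by omega)
        rcases h.T0W (by omega) b1 h2 with h4 | h4 | h4
        · omega
        · omega
        · have d1 := a1 _ h4.2.2
          have d2 := b3 _ h4.2.2
          omega
  · apply hB; omega

theorem noT_low {x : ℕ} (hx : x < c.m) (hK : h.K x = .inr true) (hb : h.P x < c.tt) : False := by
  have ha := h.nT x hx hK
  have hf12 := c.f12
  have hfm := f1_lt_m (c := c)
  have ht1 := c.t1f1
  have hbx := c.bxf
  have htm := c.hTm _ c.ttT
  have ht1tt := c.t1tt
  have hb1 := c.tmin _ c.bxT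
  have cj0 := cjf (c := c) false
  have cj1' := cjf (c := c) true
  have hm1 : 1 ≤ c.m := by omega
  have hno : ∀ p κ, c.t1 < p → p < c.tt → ¬ c.On (.inr true) p κ := by
    intro p κ h1 h2 h3
    rcases onQT.1 h3 with h4 | h4 <;> omega
  have hno2 : ∀ p κ, c.tt < p → p < c.tt + c.m + 1 → ¬ c.On (.inr true) p κ := by
    intro p κ h1 h2 h3
    rcases onQT.1 h3 with h4 | h4 <;> omega
  have R := h.run c.t1 c.tt hx hK hno ha hb
  rcases lt_trichotomy (h.P x) x with hlt | heq | hgt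
  · obtain ⟨h1, h2⟩ := R (c.t1 + x - h.P x) (by omega) (by omega) (by omega)
    set s := c.t1 + x - h.P x - 1 with hs
    have e : c.t1 + x - h.P x = s + 1 := by omega
    rw [e] at h1 h2
    have main : h.K s = .inl (true, c.jB true) → h.P s + 1 = c.cF true (c.jB true) → False := by
      intro hK' hP'
      have h0 := c.cTj1
      have hB : (c.cF true (c.jB true) = c.f1 ∧ c.f1 ≤ s + 1) ∨
          (c.cF true (c.jB true) = c.f2 ∧ c.f1 ≤ s) → False := fun hh =>
        h.lemB (by omega) (hkj true) (by omega) hK' hP' hh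
      rcases c.shape with ⟨a1, a2, a3, tl, b1, b2, b3, b4⟩ | ⟨a1, a2, a3, a4⟩
      · have RW := h.runW (x := s) (by omega) hK' (by omega) (by omega)
        rcases lt_trichotomy c.f1 (s + 1) with hl | he | hg
        · apply hB; omega
        · obtain ⟨h3, h4⟩ := RW c.bx (by omega) (by omega) (by omega)
          rcases h.T0W (by omega) c.bxT h3 with h3 | h3 | h3
          · omega
          · omega
          · have := a1 _ h3.2.2
            omega
        · rcases lt_trichotomy (c.f1 + c.t1) (c.bx + s + 1) with hl' | he' | hg'
          · obtain ⟨h3, h4⟩ := R c.f1 (by omega) (by omega) (by omega)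
            rcases h.F0T (by omega) c.f1F h3 with h5 | h5 | h5
            · omega
            · omega
            · have := c.fmin _ h5
              omega
          · obtain ⟨h3, h4⟩ := RW c.t1 (by omega) (by omega) (by omega)
            rcases h.T0W (by omega) c.t1T h3 with h3 | h3 | h3
            · omega
            · omega
            · have := a1 _ h3.2.2
              omega
          · set y := c.bx + s - c.t1 with hy
            obtain ⟨h3, h4⟩ := R y (by omega) (by omega) (by omega)
            have strt : h.K (y + 1) = .inr true → h.P (y + 1) = c.bx → False := by
              intro h5 h6
              obtain ⟨h7, h8⟩ := h.run c.tt (c.tt + c.m + 1) (x := y + 1) (by omega) h5 hno2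
                (by omega) (by omega) c.f1 (by omega) (by omega) (by omega)
              rcases h.F0T (by omega) c.f1F h7 with h5 | h5 | h5
              · omega
              · omega
              · have := c.fmin _ h5
                omega
            rcases h.step y (by omega) with ⟨h5, h6⟩ | ⟨κ, h5, h6⟩
            · exact strt (by rw [h5, h3]) (by omega)
            · rw [h3] at h5
              have hκ : κ = (false, c.jB false) := by
                rcases onQT.1 h5 with h7 | h7
                · omega
                · exact h7.2
              subst hκ
              rcases on_cases h6 with ⟨h6, h7⟩ | ⟨h6, h7⟩ | ⟨h6, h7, h8⟩ | ⟨h6, h7, h8⟩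
              · have := h.stayW (x := y + 1) (by omega) h6 (by omega)
                omega
              · exact h.lemS' h6 (by rw [h7, (cj1 hm1 false).1]) (by omega)
              · exact c.hij _ h7.symm
              · rcases h8 with h8 | h8
                · exact absurd h8.1 (by decide)
                · exact strt h6 (by omega)
      · by_cases hc : c.f1 ≤ s + 1
        · apply hB; omega
        · obtain ⟨h3, h4⟩ := R c.f1 (by omega) (by omega) (by omega)
          rcases h.F0T (by omega) c.f1F h3 with h5 | h5 | h5
          · omega
          · omega
          · have := c.fmin _ h5
            omega
    rcases h.step s (by omega) with ⟨h3, h4⟩ | ⟨κ, h3, h4⟩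
    · have := h.nT s (by omega) (by rw [← h3, h1])
      omega
    · rw [h1] at h4
      have hκ : κ = (true, c.jB true) := by
        rcases onQT.1 h4 with h5 | h5
        · exact h5.2
        · omega
      subst hκ
      rcases on_cases h3 with ⟨h6, h7⟩ | ⟨h6, h7⟩ | ⟨h6, h7, h8⟩ | ⟨h6, h7, h8⟩
      · exact main h6 h7
      · rw [(cj1 hm1 true).1] at h7
        have := h.startW (x := s) (by omega) h6 (by rw [(cj1 hm1 true).1]; omega)
        omega
      · exact c.hij _ h7.symm
      · rcases h8 with h8 | h8
        · have := h.nT s (by omega) h6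
          omega
        · exact absurd h8.1 (by decide)
  · obtain ⟨h1, h2⟩ := R c.t1 (by omega) (by omega) (by omega)
    obtain ⟨h3, h4⟩ := R (c.tt - 1) (by omega) (by omega) (by omega)
    have e : c.tt - 1 + 1 = c.tt := by omega
    have h5 := (h.T0 c.t1 (by omega) c.t1T).1 (true, c.jB true)
      (by rw [h1]; left; exact ⟨by omega, rfl⟩)
    have h6 := (h.T1 (c.tt - 1) (by omega) (by rw [e]; exact c.ttT)).1 (false, c.jB false)
      (by rw [h3]; right; exact ⟨by omega, rfl⟩)
    exact h.hcol (h5.trans h6.symm)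
  · set y := x + c.tt - 1 - h.P x with hy
    obtain ⟨h1, h2⟩ := R y (by omega) (by omega) (by omega)
    by_cases hc : y + 1 < c.f1
    · have strt : h.K (y + 1) = .inr true → h.P (y + 1) = c.tt → False := by
        intro h5 h6
        have := h.stay (x := y + 1) (by omega) h5 (by
          intro p κ h1 h3
          rcases onQT.1 h3 with h4 | h4 <;> omega)
        omega
      rcases h.step y (by omega) with ⟨h5, h6⟩ | ⟨κ, h5, h6⟩
      · exact strt (by rw [h5, h1]) (by omega)
      · rw [h1] at h5
        have hκ : κ = (false, c.jB false) := by
          rcases onQT.1 h5 with h7 | h7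
          · omega
          · exact h7.2
        subst hκ
        rcases on_cases h6 with ⟨h6, h7⟩ | ⟨h6, h7⟩ | ⟨h6, h7, h8⟩ | ⟨h6, h7, h8⟩
        · have := h.stayW (x := y + 1) (by omega) h6 (by omega)
          omega
        · exact h.lemS' h6 (by rw [h7, (cj1 hm1 false).1]) (by omega)
        · exact c.hij _ h7.symm
        · rcases h8 with h8 | h8
          · exact absurd h8.1 (by decide)
          · exact strt h6 (by omega)
    · rcases c.shape with ⟨a1, a2, a3, tl, b1, b2, b3, b4⟩ | ⟨a1, a2, a3, a4⟩
      · omega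
      · obtain ⟨h3, h4⟩ := R c.bx (by omega) (by omega) (by omega)
        rcases h.T0T (by omega) c.bxT h3 with h5 | h5 | h5
        · omega
        · omega
        · have d1 := c.bxmax _ h5
          have d2 := a2 _ h5
          have d3 : h.P c.bx ≠ c.f1 := by
            intro d
            rw [d] at h5
            exact c.hdis _ c.f1F h5
          omega

theorem noT {x : ℕ} (hx : x < c.m) (hK : h.K x = .inr true) : False := by
  by_cases hb : h.P x < c.tt
  · exact h.noT_low hx hK hb
  have ht1tt := c.t1tt
  have hfm := f1_lt_m (c := c)
  have hst := h.stay (x := x) (by omega) hK (by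
          intro p κ h1 h3
          rcases onQT.1 h3 with h4 | h4 <;> omega)
  set s := c.tt + x - h.P x - 1 with hs
  have hp := h.hP x hx
  obtain ⟨h1, h2⟩ := h.run c.tt (c.tt + c.m + 1) hx hK (by
    intro p κ h1 h2 h3
    rcases onQT.1 h3 with h4 | h4 <;> omega) (by omega) (by omega) (s + 1) (by omega) (by omega) (by omega)
  rcases h.step s (by omega) with ⟨h3, h4⟩ | ⟨κ, h3, h4⟩
  · exact h.noT_low (x := s) (by omega) (by rw [← h3, h1]) (by omega)
  · rw [h1] at h4
    have hκ : κ = (false, c.jB false) := by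
      rcases onQT.1 h4 with h7 | h7
      · omega
      · exact h7.2
    subst hκ
    rcases on_cases h3 with ⟨h6, h7⟩ | ⟨h6, h7⟩ | ⟨h6, h7, h8⟩ | ⟨h6, h7, h8⟩
    · exact h.lemE (by omega) h1 (by omega) (by omega) h6 h7
    · rw [(cj1 (by omega) false).1] at h7
      have := h.startW (x := s) (by omega) h6 (by rw [(cj1 (by omega) false).1]; omega)
      omega
    · exact c.hij _ h7.symm
    · rcases h8 with h8 | h8
      · exact absurd h8.1 (by decide)
      · exact h.noT_low (x := s) (by omega) h6 (by omega)

end Wk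

namespace Wk
variable {n : ℕ} {c : Cfg n} (h : Wk c)

theorem wstep {y : ℕ} {w : Bool} {k : ZMod n} (hy : y + 1 < c.m) (hK : h.K y = .inl (w, k)) :
    (h.K (y + 1) = .inl (w, k) ∧ h.P (y + 1) = h.P y + 1) ∨
    (h.P y + 1 = c.cF w k ∧ h.K (y + 1) = .inl (w, k + 1) ∧ h.P (y + 1) = c.cT w (k + 1)) := by
  rcases h.stepW hy hK with h1 | ⟨h1, h2⟩ | ⟨h1, h2⟩
  · exact Or.inl h1
  · rcases on_cases h2 with ⟨h6, h7⟩ | ⟨h6, h7⟩ | ⟨h6, h7, h8⟩ | ⟨h6, h7, h8⟩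
    · left; exact ⟨h6, by omega⟩
    · right; exact ⟨h1, h6, h7⟩
    · exact (h.noF hy h6).elim
    · exact (h.noT hy h6).elim
  · rcases on_cases h2 with ⟨h6, h7⟩ | ⟨h6, h7⟩ | ⟨h6, h7, h8⟩ | ⟨h6, h7, h8⟩
    · have a1 := h.startW (x := y) (by omega) hK (by omega)
      have a2 := h.stayW hy h6 (by omega)
      have a3 := c.cond2 w (k - 1)
      rw [sub_add_cancel] at a3
      omega
    · rw [sub_add_cancel] at h6 h7
      left; exact ⟨h6, by omega⟩
    · exact (h.noF hy h6).elim
    · exact (h.noT hy h6).elim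

theorem wconst : ∃ w, ∀ e, e < c.m → ∃ k, h.K e = .inl (w, k) := by
  have hfm := f1_lt_m (c := c)
  rcases hK0 : h.K 0 with ⟨w, k⟩ | b
  · refine ⟨w, ?_⟩
    intro e
    induction e with
    | zero => intro _; exact ⟨k, hK0⟩
    | succ e ih =>
      intro he
      obtain ⟨k', hk'⟩ := ih (by omega)
      rcases h.wstep he hk' with h1 | h1
      · exact ⟨_, h1.1⟩
      · exact ⟨_, h1.2.1⟩
  · cases b
    · exact (h.noF (by omega) hK0).elim
    · exact (h.noT (by omega) hK0).elim

theorem d0 {w : Bool} {k : ZMod n} (hK : h.K 0 = .inl (w, k)) : h.P 0 ≠ 0 := by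
  intro h0
  have hfm := f1_lt_m (c := c)
  have c1 := c.cond1 w k
  have hF := c.hFm _ (c.hcF w k)
  by_cases hc : c.cT w k = 0
  · exact h.zeroW (x := 0) (by omega) hK (by omega) (by omega) h0
  obtain ⟨h1, h2⟩ := h.run 0 (c.cT w k) (x := 0) (by omega) hK (by
    intro p κ h1 h2 h3
    rcases (onW.1 h3).2 with ⟨h3, _⟩ | ⟨h3, _⟩ <;> omega) (by omega) (by omega)
    (c.cT w k - 1) (by omega) (by omega) (by omega)
  have e : c.cT w k - 1 + 1 = c.cT w k := by omega
  have h3 := h.wstep (by omega) h1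
  rw [e] at h3
  rcases h3 with h3 | h3
  · exact h.zeroW (x := c.cT w k) (by omega) h3.1 (by omega) (by omega) (by omega)
  · omega

theorem d1 {w : Bool} (hw : ∀ e, e < c.m → ∃ k, h.K e = .inl (w, k)) : h.P (c.m - 1) ≠ c.m - 1 := by
  intro h0
  have hfm := f1_lt_m (c := c)
  obtain ⟨k, hK⟩ := hw (c.m - 1) (by omega)
  have c1 := c.cond1 w k
  have hF := c.hFm _ (c.hcF w k)
  by_cases hc : c.cF w k = c.m
  · exact h.zeroW (x := c.m - 1) (by omega) hK (by omega) (by omega) h0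
  obtain ⟨h1, h2⟩ := h.run (c.cF w k) (c.m + 1) (x := c.m - 1) (by omega) hK (by
    intro p κ h1 h2 h3
    rcases (onW.1 h3).2 with ⟨h3, _⟩ | ⟨h3, _⟩ <;> omega) (by omega) (by omega)
    (c.cF w k) (by omega) (by omega) (by omega)
  have e : c.cF w k - 1 + 1 = c.cF w k := by omega
  obtain ⟨k', hK'⟩ := hw (c.cF w k - 1) (by omega)
  have h3 := h.wstep (by omega) hK'
  rw [e] at h3
  rcases h3 with h3 | h3
  · have : k' = k := by
      have := h3.1.symm.trans h1
      simpa using this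
    subst this
    exact h.zeroW (x := c.cF w k' - 1) (by omega) hK' (by omega) (by omega) (by omega)
  · have : k' + 1 = k := by
      have := h3.2.1.symm.trans h1
      simpa using this
    rw [this] at h3
    omega

/-- There is no walk. -/
theorem absurd_walk {n : ℕ} {c : Cfg n} (h : Wk c) : False := by
  have hfm := f1_lt_m (c := c)
  obtain ⟨w, hw⟩ := h.wconst
  obtain ⟨k0, hk0⟩ := hw 0 (by omega)
  have hd0 := h.d0 hk0
  have hd1 := h.d1 hw
  have hP1 := h.hP (c.m - 1) (by omega)
  set d : ℤ → ℤ := fun y => (h.P y.toNat : ℤ) - y.toNat with hd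
  have dn : ∀ y : ℕ, d y = (h.P y : ℤ) - y := by intro y; simp [hd]
  have sw : ∀ y : ℤ, 1 ≤ y → y ≤ c.m - 1 → d y ≠ d (y - 1) → ∃ e : ℕ, ∃ k, y = (e : ℤ) + 1 ∧ e + 1 < c.m ∧
      h.K e = .inl (w, k) ∧ 
      (h.P e + 1 = c.cF w k ∧ h.K (e + 1) = .inl (w, k + 1) ∧ h.P (e + 1) = c.cT w (k + 1)) := by
    intro y h1 h2 h3
    have he : y = ((y - 1).toNat : ℤ) + 1 := by omega
    refine ⟨(y - 1).toNat, ?_⟩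
    obtain ⟨k, hk⟩ := hw (y - 1).toNat (by omega)
    refine ⟨k, he, by omega, hk, ?_⟩
    rcases h.wstep (by omega) hk with h4 | h4
    · exfalso
      apply h3
      set e := (y - 1).toNat
      rw [he, add_sub_cancel_right, dn e, show ((e : ℤ) + 1) = ((e + 1 : ℕ) : ℤ) by push_cast; rfl, dn (e + 1), h4.2]
      push_cast; ring
    · exact h4
  have dm : d ((c.m : ℤ) - 1) = (h.P (c.m - 1) : ℤ) - ((c.m : ℤ) - 1) := by
    have : (c.m : ℤ) - 1 = ((c.m - 1 : ℕ) : ℤ) := by omega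
    rw [this, dn]
  cases hc : h.col w
  · refine shift_aux c.m d (fun x => ∃ a ∈ c.FL, x = (a : ℤ)) (by omega) ?_ ?_ ?_ ?_ ?_ ?_
    · rintro x ⟨a, ha, rfl⟩
      exact_mod_cast c.hFm a ha
    · have := dn 0; simp at this; rw [this]; omega
    · rw [dm]; omega
    · intro y h1 h2 h3
      obtain ⟨e, k, rfl, he, hK, a1, a2, a3⟩ := sw y h1 h2 h3
      have := dn (e + 1)
      push_cast at this
      rw [this]; omega
    · intro y h1 h2 h3
      obtain ⟨e, k, rfl, he, hK, a1, a2, a3⟩ := sw y h1 h2 h3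
      refine ⟨⟨c.cF w k, c.hcF w k, ?_⟩, ?_⟩
      · rw [add_sub_cancel_right, dn]; omega
      · rintro ⟨a, ha, hae⟩
        have : a = e + 1 := by omega
        subst this
        rcases h.F0W he ha a2 with h4 | h4 | h4
        · rw [hc] at h4; exact absurd h4.2 (by decide)
        · rw [hc] at h4; exact absurd h4.2 (by decide)
        · exact h4.2.1 a3
    · rintro x h1 h2 ⟨a, ha, rfl⟩
      obtain ⟨e, rfl⟩ : ∃ e, a = e + 1 := ⟨a - 1, by omega⟩
      obtain ⟨k, hk⟩ := hw e (by omega)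
      refine ⟨h.P e + 1, ?_, ?_⟩
      · rcases h.F1W (by omega) ha hk with h4 | h4 | h4
        · rw [hc] at h4; exact absurd h4.2 (by decide)
        · rw [hc] at h4; exact absurd h4.2 (by decide)
        · exact h4.2.2
      · push_cast; rw [add_sub_cancel_right, dn]; ring
  · refine shift_aux' c.m d (fun x => ∃ a ∈ c.TL, x = (a : ℤ)) (by omega) ?_ ?_ ?_ ?_ ?_ ?_
    · rintro x ⟨a, ha, rfl⟩
      omega
    · have := dn 0; simp at this; rw [this]; omega
    · rw [dm]; omega
    · intro y h1 h2 h3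
      obtain ⟨e, k, rfl, he, hK, a1, a2, a3⟩ := sw y h1 h2 h3
      have := h.hP e (by omega)
      rw [add_sub_cancel_right, dn]; omega
    · intro y h1 h2 h3
      obtain ⟨e, k, rfl, he, hK, a1, a2, a3⟩ := sw y h1 h2 h3
      refine ⟨⟨c.cT w (k + 1), c.hcT w _, ?_⟩, ?_⟩
      · have := dn (e + 1)
        push_cast at this
        rw [this]; omega
      · rintro ⟨a, ha, hae⟩
        have : a = e + 1 := by omega
        subst this
        rcases h.T0W he ha a2 with h4 | h4 | h4
        · rw [hc] at h4; exact absurd h4.2 (by decide)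
        · rw [hc] at h4; exact absurd h4.2 (by decide)
        · exact h4.2.1 a3
    · rintro x h1 h2 ⟨a, ha, rfl⟩
      obtain ⟨k, hk⟩ := hw a (by omega)
      refine ⟨h.P a, ?_, ?_⟩
      · rcases h.T0W (by omega) ha hk with h4 | h4 | h4
        · rw [hc] at h4; exact absurd h4.2 (by decide)
        · rw [hc] at h4; exact absurd h4.2 (by decide)
        · exact h4.2.2
      · rw [dn]; ring

end Wk

section core
variable {σ : Type} {n : ℕ} (C : Cfg n)

/-- The node of the bike at position `p` of a copy. -/
noncomputable def Cfg.emb : Cp n → ℕ → BInd n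
  | .inl (w, k) => fun v => Sum.inl (bwNorm n C.cT C.cF w k v)
  | .inr false => embF n C.cF C.iB C.f1 C.f2
  | .inr true => embT n C.cF C.jB C.t1 C.tt

/-- The contact nodes. -/
def Cfg.ct (κ : Bool × ZMod n) : BInd n := Sum.inl (κ.1, κ.2, C.cF κ.1 κ.2)

/-- A non-contact node. -/
def nonC : Cp n → ℕ → BInd n
  | .inl (w, k), p => Sum.inl (w, k, p)
  | .inr b, p => Sum.inr (b, p)

theorem nonC_inj {X Y : Cp n} {p q : ℕ} (hh : nonC X p = nonC Y q) : X = Y ∧ p = q := by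
  rcases X with ⟨w, k⟩ | b <;> rcases Y with ⟨w', k'⟩ | b' <;> simp [nonC] at hh ⊢ <;> tauto

theorem emb_on {X : Cp n} {p : ℕ} {κ : Bool × ZMod n} (hh : C.On X p κ) : C.emb X p = C.ct κ := by
  obtain ⟨w, k⟩ := κ
  have f12 := C.f12
  have t1tt := C.t1tt
  rcases Wk.on_cases hh with ⟨rfl, rfl⟩ | ⟨rfl, rfl⟩ | ⟨rfl, rfl, ⟨rfl, rfl⟩ | ⟨rfl, rfl⟩⟩ |
      ⟨rfl, rfl, ⟨rfl, rfl⟩ | ⟨rfl, rfl⟩⟩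
  · have := C.cond1 w k
    simp [Cfg.emb, Cfg.ct, bwNorm, this.ne']
  · simp [Cfg.emb, Cfg.ct, bwNorm]
  · simp [Cfg.emb, Cfg.ct, embF]
  · simp [Cfg.emb, Cfg.ct, embF, f12.ne']
  · simp [Cfg.emb, Cfg.ct, embT]
  · simp [Cfg.emb, Cfg.ct, embT, t1tt.ne']

theorem emb_non {X : Cp n} {p : ℕ} (hh : ∀ κ, ¬ C.On X p κ) : C.emb X p = nonC X p := by
  rcases X with ⟨w, k⟩ | b
  · have : p ≠ C.cT w k := fun e => hh (w, k - 1) ⟨rfl, Or.inr ⟨e, rfl⟩⟩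
    simp [Cfg.emb, nonC, bwNorm, this]
  · cases b
    · have h1 : p ≠ C.f1 := fun e => hh _ (Or.inl ⟨e, rfl⟩)
      have h2 : p ≠ C.f2 := fun e => hh _ (Or.inr ⟨e, rfl⟩)
      simp [Cfg.emb, nonC, embF, h1, h2]
    · have h1 : p ≠ C.t1 := fun e => hh _ (Or.inl ⟨e, rfl⟩)
      have h2 : p ≠ C.tt := fun e => hh _ (Or.inr ⟨e, rfl⟩)
      simp [Cfg.emb, nonC, embT, h1, h2]

theorem on_of_emb {X : Cp n} {p : ℕ} {κ : Bool × ZMod n} (hh : C.emb X p = C.ct κ) : C.On X p κ := by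
  by_cases h1 : ∃ κ', C.On X p κ'
  · obtain ⟨κ', h2⟩ := h1
    rw [emb_on C h2] at hh
    have : κ' = κ := by
      obtain ⟨w, k⟩ := κ
      obtain ⟨w', k'⟩ := κ'
      simp [Cfg.ct] at hh
      simp [hh.1, hh.2.1]
    rwa [← this]
  · push Not at h1
    rw [emb_non C h1] at hh
    rcases X with ⟨w, k⟩ | b
    · simp [nonC, Cfg.ct] at hh
      obtain ⟨h2, h3, h4⟩ := hh
      subst h2 h3
      exact ⟨rfl, Or.inl ⟨h4, rfl⟩⟩
    · simp [nonC, Cfg.ct] at hh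

theorem emb_inj {X Y : Cp n} {p q : ℕ} (hh : C.emb X p = C.emb Y q) :
    (X = Y ∧ p = q) ∨ ∃ κ, C.On X p κ ∧ C.On Y q κ := by
  by_cases h1 : ∃ κ', C.On X p κ'
  · obtain ⟨κ, h2⟩ := h1
    right; refine ⟨κ, h2, on_of_emb C ?_⟩
    rw [← hh, emb_on C h2]
  by_cases h3 : ∃ κ', C.On Y q κ'
  · obtain ⟨κ, h2⟩ := h3
    right; refine ⟨κ, on_of_emb C ?_, h2⟩
    rw [hh, emb_on C h2]
  · push Not at h1 h3
    rw [emb_non C h1, emb_non C h3] at hh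
    left; exact nonC_inj hh

/-- The labelled copies. -/
def Cfg.cp (ρ : ℕ → σ) : Cp n → Set (At σ ℕ)
  | .inl (w, k) => contactCopy (pathCQ σ C.m ρ C.FL C.TL) (C.cT w k) (C.cF w k)
  | .inr false => insert (At.A C.f1) (insert (At.A C.f2)
      (pathCQ σ C.m ρ C.FL C.TL \ {At.F C.f1, At.F C.f2}))
  | .inr true => insert (At.A C.t1) (insert (At.A C.tt)
      (pathCQ σ C.m ρ C.FL C.TL \ {At.T C.t1, At.T C.tt}))

/-- The bike of a configuration. -/
def Cfg.bk (ρ : ℕ → σ) : Set (At σ (BInd n)) :=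
  bike σ n (pathCQ σ C.m ρ C.FL C.TL) C.cT C.cF C.iB C.jB C.f1 C.f2 C.t1 C.tt

theorem mem_bk (ρ : ℕ → σ) (a : At σ (BInd n)) :
    a ∈ C.bk ρ ↔ ∃ X, ∃ b ∈ C.cp ρ X, a = At.map (C.emb X) b := by
  constructor
  · rintro ((⟨w, j, b, hb, rfl⟩ | ⟨b, hb, rfl⟩) | ⟨b, hb, rfl⟩)
    · exact ⟨.inl (w, j), b, hb, rfl⟩
    · exact ⟨.inr false, b, hb, rfl⟩
    · exact ⟨.inr true, b, hb, rfl⟩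
  · rintro ⟨⟨w, k⟩ | b, a, ha, rfl⟩
    · exact Or.inl (Or.inl ⟨w, k, a, ha, rfl⟩)
    · cases b
      · exact Or.inl (Or.inr ⟨a, ha, rfl⟩)
      · exact Or.inr ⟨a, ha, rfl⟩

theorem F_path (ρ : ℕ → σ) (x : ℕ) : At.F x ∈ pathCQ σ C.m ρ C.FL C.TL ↔ x ∈ C.FL := by
  simp [pathCQ]

theorem T_path (ρ : ℕ → σ) (x : ℕ) : At.T x ∈ pathCQ σ C.m ρ C.FL C.TL ↔ x ∈ C.TL := by
  simp [pathCQ]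

theorem A_path (ρ : ℕ → σ) (x : ℕ) : At.A x ∉ pathCQ σ C.m ρ C.FL C.TL := by
  simp [pathCQ]

theorem R_path (ρ : ℕ → σ) (r : σ) (x y : ℕ) : At.R r x y ∈ pathCQ σ C.m ρ C.FL C.TL ↔
    x < C.m ∧ y = x + 1 ∧ r = ρ x := by
  simp only [pathCQ, Set.mem_setOf_eq, At.R.injEq, reduceCtorEq, and_false, exists_false, or_false]
  constructor
  · rintro ⟨i, h1, h2, rfl, h4⟩
    exact ⟨h1, h4, h2⟩
  · rintro ⟨h1, h2, h3⟩
    exact ⟨x, h1, h3, rfl, h2⟩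

theorem F_cp (ρ : ℕ → σ) (X : Cp n) (x : ℕ) : At.F x ∈ C.cp ρ X ↔ x ∈ C.FL ∧ ∀ κ, ¬ C.On X x κ := by
  rcases X with ⟨w, k⟩ | b
  · simp only [Cfg.cp, contactCopy, Set.mem_insert_iff, reduceCtorEq, false_or, Set.mem_sdiff, F_path,
      Set.mem_singleton_iff, At.F.injEq]
    constructor
    · rintro ⟨h1, h2⟩
      refine ⟨h1, fun κ h3 => ?_⟩
      rcases (Wk.onW.1 h3).2 with h4 | h4
      · exact h2 h4.1
      · exact C.hdis _ h1 (by rw [h4.1]; exact C.hcT w k)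
    · rintro ⟨h1, h2⟩
      exact ⟨h1, fun h3 => h2 (w, k) ⟨rfl, Or.inl ⟨h3, rfl⟩⟩⟩
  · cases b
    · simp only [Cfg.cp, Set.mem_insert_iff, reduceCtorEq, false_or, Set.mem_sdiff, F_path,
      Set.mem_singleton_iff, At.F.injEq]
      constructor
      · rintro ⟨h1, h2⟩
        refine ⟨h1, fun κ h3 => ?_⟩
        rcases Wk.onQF.1 h3 with h4 | h4
        · exact h2 (Or.inl h4.1)
        · exact h2 (Or.inr h4.1)
      · rintro ⟨h1, h2⟩
        refine ⟨h1, fun h3 => ?_⟩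
        rcases h3 with h3 | h3
        · exact h2 _ (Or.inl ⟨h3, rfl⟩)
        · exact h2 _ (Or.inr ⟨h3, rfl⟩)
    · simp only [Cfg.cp, Set.mem_insert_iff, reduceCtorEq, false_or, Set.mem_sdiff, F_path,
      Set.mem_singleton_iff]
      constructor
      · rintro ⟨h1, h2⟩
        refine ⟨h1, fun κ h3 => ?_⟩
        rcases Wk.onQT.1 h3 with h4 | h4
        · exact C.hdis _ h1 (by rw [h4.1]; exact C.t1T)
        · exact C.hdis _ h1 (by rw [h4.1]; exact C.ttT)
      · rintro ⟨h1, h2⟩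
        exact ⟨h1, by simp⟩

theorem T_cp (ρ : ℕ → σ) (X : Cp n) (x : ℕ) : At.T x ∈ C.cp ρ X ↔ x ∈ C.TL ∧ ∀ κ, ¬ C.On X x κ := by
  rcases X with ⟨w, k⟩ | b
  · simp only [Cfg.cp, contactCopy, Set.mem_insert_iff, reduceCtorEq, false_or, Set.mem_sdiff, T_path,
      Set.mem_singleton_iff, At.T.injEq, or_false]
    constructor
    · rintro ⟨h1, h2⟩
      refine ⟨h1, fun κ h3 => ?_⟩
      rcases (Wk.onW.1 h3).2 with h4 | h4
      · exact C.hdis x (by rw [h4.1]; exact C.hcF w k) h1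
      · exact h2 h4.1
    · rintro ⟨h1, h2⟩
      exact ⟨h1, fun h3 => h2 (w, k - 1) ⟨rfl, Or.inr ⟨h3, rfl⟩⟩⟩
  · cases b
    · simp only [Cfg.cp, Set.mem_insert_iff, reduceCtorEq, false_or, Set.mem_sdiff, T_path,
      Set.mem_singleton_iff]
      constructor
      · rintro ⟨h1, h2⟩
        refine ⟨h1, fun κ h3 => ?_⟩
        rcases Wk.onQF.1 h3 with h4 | h4
        · exact C.hdis x (by rw [h4.1]; exact C.f1F) h1
        · exact C.hdis x (by rw [h4.1]; exact C.f2F) h1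
      · rintro ⟨h1, h2⟩
        exact ⟨h1, by simp⟩
    · simp only [Cfg.cp, Set.mem_insert_iff, reduceCtorEq, false_or, Set.mem_sdiff, T_path,
      Set.mem_singleton_iff, At.T.injEq]
      constructor
      · rintro ⟨h1, h2⟩
        refine ⟨h1, fun κ h3 => ?_⟩
        rcases Wk.onQT.1 h3 with h4 | h4
        · exact h2 (Or.inl h4.1)
        · exact h2 (Or.inr h4.1)
      · rintro ⟨h1, h2⟩
        refine ⟨h1, fun h3 => ?_⟩
        rcases h3 with h3 | h3
        · exact h2 _ (Or.inl ⟨h3, rfl⟩)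
        · exact h2 _ (Or.inr ⟨h3, rfl⟩)

theorem A_cp (ρ : ℕ → σ) (X : Cp n) (x : ℕ) : At.A x ∈ C.cp ρ X ↔ ∃ κ, C.On X x κ := by
  have hA := A_path C ρ x
  rcases X with ⟨w, k⟩ | b
  · simp only [Cfg.cp, contactCopy, Set.mem_insert_iff, At.A.injEq, Set.mem_sdiff, hA, false_and, or_false]
    constructor
    · rintro (h1 | h1)
      · exact ⟨(w, k - 1), rfl, Or.inr ⟨h1, rfl⟩⟩
      · exact ⟨(w, k), rfl, Or.inl ⟨h1, rfl⟩⟩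
    · rintro ⟨κ, h1⟩
      rcases (Wk.onW.1 h1).2 with h4 | h4
      · exact Or.inr h4.1
      · exact Or.inl h4.1
  · cases b
    · simp only [Cfg.cp, Set.mem_insert_iff, At.A.injEq, Set.mem_sdiff, hA, false_and, or_false]
      constructor
      · rintro (h1 | h1)
        · exact ⟨_, Or.inl ⟨h1, rfl⟩⟩
        · exact ⟨_, Or.inr ⟨h1, rfl⟩⟩
      · rintro ⟨κ, h1⟩
        rcases Wk.onQF.1 h1 with h4 | h4
        · exact Or.inl h4.1
        · exact Or.inr h4.1
    · simp only [Cfg.cp, Set.mem_insert_iff, At.A.injEq, Set.mem_sdiff, hA, false_and, or_false]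
      constructor
      · rintro (h1 | h1)
        · exact ⟨_, Or.inl ⟨h1, rfl⟩⟩
        · exact ⟨_, Or.inr ⟨h1, rfl⟩⟩
      · rintro ⟨κ, h1⟩
        rcases Wk.onQT.1 h1 with h4 | h4
        · exact Or.inl h4.1
        · exact Or.inr h4.1

theorem R_cp (ρ : ℕ → σ) (X : Cp n) (r : σ) (x y : ℕ) : At.R r x y ∈ C.cp ρ X ↔
    x < C.m ∧ y = x + 1 ∧ r = ρ x := by
  rcases X with ⟨w, k⟩ | b
  · simp [Cfg.cp, contactCopy, R_path]
  · cases b <;> simp [Cfg.cp, R_path]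

theorem F_bk (ρ : ℕ → σ) (a : BInd n) : At.F a ∈ C.bk ρ ↔
    ∃ X p, a = C.emb X p ∧ p ∈ C.FL ∧ ∀ κ, ¬ C.On X p κ := by
  rw [mem_bk]
  constructor
  · rintro ⟨X, b, hb, he⟩
    cases b <;> simp [At.map] at he
    exact ⟨X, _, he, (F_cp C ρ X _).1 hb⟩
  · rintro ⟨X, p, he, hp⟩
    exact ⟨X, At.F p, (F_cp C ρ X p).2 hp, by simp [At.map, he]⟩

theorem T_bk (ρ : ℕ → σ) (a : BInd n) : At.T a ∈ C.bk ρ ↔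
    ∃ X p, a = C.emb X p ∧ p ∈ C.TL ∧ ∀ κ, ¬ C.On X p κ := by
  rw [mem_bk]
  constructor
  · rintro ⟨X, b, hb, he⟩
    cases b <;> simp [At.map] at he
    exact ⟨X, _, he, (T_cp C ρ X _).1 hb⟩
  · rintro ⟨X, p, he, hp⟩
    exact ⟨X, At.T p, (T_cp C ρ X p).2 hp, by simp [At.map, he]⟩

theorem A_bk (ρ : ℕ → σ) (a : BInd n) : At.A a ∈ C.bk ρ ↔ ∃ κ, a = C.ct κ := by
  rw [mem_bk]
  constructor
  · rintro ⟨X, b, hb, he⟩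
    cases b <;> simp [At.map] at he
    obtain ⟨κ, hκ⟩ := (A_cp C ρ X _).1 hb
    exact ⟨κ, by rw [he, emb_on C hκ]⟩
  · rintro ⟨⟨w, k⟩, he⟩
    have : C.On (.inl (w, k)) (C.cF w k) (w, k) := ⟨rfl, Or.inl ⟨rfl, rfl⟩⟩
    exact ⟨.inl (w, k), At.A (C.cF w k), (A_cp C ρ _ _).2 ⟨_, this⟩, by
      simp only [At.map, emb_on C this, he]⟩

theorem R_bk (ρ : ℕ → σ) (r : σ) (a b : BInd n) : At.R r a b ∈ C.bk ρ ↔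
    ∃ X p, p < C.m ∧ r = ρ p ∧ a = C.emb X p ∧ b = C.emb X (p + 1) := by
  rw [mem_bk]
  constructor
  · rintro ⟨X, b, hb, he⟩
    cases b <;> simp [At.map] at he
    obtain ⟨h1, rfl, rfl⟩ := (R_cp C ρ X _ _ _).1 hb
    exact ⟨X, _, h1, he⟩
  · rintro ⟨X, p, h1, h2, h3, h4⟩
    exact ⟨X, At.R r p (p + 1), (R_cp C ρ X _ _ _).2 ⟨h1, rfl, h2⟩, by simp [At.map, h3, h4]⟩

theorem und_iff (ρ : ℕ → σ) (a : BInd n) : undecided (C.bk ρ) a ↔ ∃ κ, a = C.ct κ := by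
  rw [undecided, A_bk, F_bk, T_bk]
  constructor
  · exact fun h => h.1
  · rintro ⟨κ, rfl⟩
    refine ⟨⟨κ, rfl⟩, ?_, ?_⟩
    · rintro ⟨X, p, h1, h2, h3⟩
      exact h3 κ (on_of_emb C h1.symm)
    · rintro ⟨X, p, h1, h2, h3⟩
      exact h3 κ (on_of_emb C h1.symm)

theorem FS_ct (ρ : ℕ → σ) (c : BInd n → Bool) (κ : Bool × ZMod n) :
    (minModel (C.bk ρ) c).FS (C.ct κ) ↔ c (C.ct κ) = true := by
  have h := (und_iff C ρ (C.ct κ)).2 ⟨κ, rfl⟩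
  constructor
  · rintro (h1 | h1)
    · exact absurd h1 h.2.1
    · exact h1.2
  · intro h1; exact Or.inr ⟨h, h1⟩

theorem TS_ct (ρ : ℕ → σ) (c : BInd n → Bool) (κ : Bool × ZMod n) :
    (minModel (C.bk ρ) c).TS (C.ct κ) ↔ c (C.ct κ) = false := by
  have h := (und_iff C ρ (C.ct κ)).2 ⟨κ, rfl⟩
  constructor
  · rintro (h1 | h1)
    · exact absurd h1 h.2.2
    · exact h1.2
  · intro h1; exact Or.inr ⟨h, h1⟩

theorem FS_emb (ρ : ℕ → σ) (c : BInd n → Bool) (X : Cp n) (p : ℕ) :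
    (minModel (C.bk ρ) c).FS (C.emb X p) ↔ (∀ κ, C.On X p κ → c (C.ct κ) = true) ∧
      ((∀ κ, ¬ C.On X p κ) → p ∈ C.FL) := by
  by_cases h1 : ∃ κ, C.On X p κ
  · obtain ⟨κ, hκ⟩ := h1
    rw [emb_on C hκ, FS_ct]
    constructor
    · intro h2
      refine ⟨fun κ' h3 => ?_, fun h3 => absurd hκ (h3 κ)⟩
      rw [← emb_on C h3, emb_on C hκ, h2]
    · intro h2; exact h2.1 κ hκ
  · push Not at h1
    constructor
    · rintro (h2 | h2)
      · obtain ⟨Y, q, h3, h4, h5⟩ := (F_bk C ρ _).1 h2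
        refine ⟨fun κ h => absurd h (h1 κ), fun _ => ?_⟩
        rcases emb_inj C h3 with ⟨rfl, rfl⟩ | ⟨κ, h6, h7⟩
        · exact h4
        · exact absurd h6 (h1 κ)
      · obtain ⟨κ, hκ⟩ := (und_iff C ρ _).1 h2.1
        exact absurd (on_of_emb C hκ) (h1 κ)
    · intro h2
      exact Or.inl ((F_bk C ρ _).2 ⟨X, p, rfl, h2.2 h1, h1⟩)

theorem TS_emb (ρ : ℕ → σ) (c : BInd n → Bool) (X : Cp n) (p : ℕ) :
    (minModel (C.bk ρ) c).TS (C.emb X p) ↔ (∀ κ, C.On X p κ → c (C.ct κ) = false) ∧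
      ((∀ κ, ¬ C.On X p κ) → p ∈ C.TL) := by
  by_cases h1 : ∃ κ, C.On X p κ
  · obtain ⟨κ, hκ⟩ := h1
    rw [emb_on C hκ, TS_ct]
    constructor
    · intro h2
      refine ⟨fun κ' h3 => ?_, fun h3 => absurd hκ (h3 κ)⟩
      rw [← emb_on C h3, emb_on C hκ, h2]
    · intro h2; exact h2.1 κ hκ
  · push Not at h1
    constructor
    · rintro (h2 | h2)
      · obtain ⟨Y, q, h3, h4, h5⟩ := (T_bk C ρ _).1 h2
        refine ⟨fun κ h => absurd h (h1 κ), fun _ => ?_⟩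
        rcases emb_inj C h3 with ⟨rfl, rfl⟩ | ⟨κ, h6, h7⟩
        · exact h4
        · exact absurd h6 (h1 κ)
      · obtain ⟨κ, hκ⟩ := (und_iff C ρ _).1 h2.1
        exact absurd (on_of_emb C hκ) (h1 κ)
    · intro h2
      exact Or.inl ((T_bk C ρ _).2 ⟨X, p, rfl, h2.2 h1, h1⟩)

/-- Satisfaction of a path CQ. -/
theorem sat_path (ρ : ℕ → σ) (I : Interp σ (BInd n)) :
    I.satCQ (pathCQ σ C.m ρ C.FL C.TL) ↔ ∃ h : ℕ → BInd n,
      (∀ e, e < C.m → I.RS (ρ e) (h e) (h (e + 1))) ∧ (∀ e ∈ C.FL, I.FS (h e)) ∧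
      (∀ e ∈ C.TL, I.TS (h e)) := by
  constructor
  · rintro ⟨h, hh⟩
    refine ⟨h, fun e he => ?_, fun e he => ?_, fun e he => ?_⟩
    · exact hh (At.R (ρ e) e (e + 1)) (Or.inl ⟨e, he, rfl⟩)
    · exact hh (At.F e) (Or.inr (Or.inl ⟨e, he, rfl⟩))
    · exact hh (At.T e) (Or.inr (Or.inr ⟨e, he, rfl⟩))
  · rintro ⟨h, h1, h2, h3⟩
    refine ⟨h, ?_⟩
    rintro a (⟨i, hi, rfl⟩ | ⟨i, hi, rfl⟩ | ⟨i, hi, rfl⟩)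
    · exact h1 i hi
    · exact h2 i hi
    · exact h3 i hi

/-- Each copy with correctly coloured contacts yields a homomorphism. -/
theorem sat_of_copy (ρ : ℕ → σ) (c : BInd n → Bool) (X : Cp n)
    (h1 : ∀ p ∈ C.FL, ∀ κ, C.On X p κ → c (C.ct κ) = true)
    (h2 : ∀ p ∈ C.TL, ∀ κ, C.On X p κ → c (C.ct κ) = false) :
    (minModel (C.bk ρ) c).satCQ (pathCQ σ C.m ρ C.FL C.TL) := by
  rw [sat_path]
  refine ⟨C.emb X, fun e he => ?_, fun e he => ?_, fun e he => ?_⟩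
  · exact (R_bk C ρ _ _ _).2 ⟨X, e, he, rfl, rfl, rfl⟩
  · exact (FS_emb C ρ c X e).2 ⟨h1 e he, fun _ => he⟩
  · exact (TS_emb C ρ c X e).2 ⟨h2 e he, fun _ => he⟩

theorem core_fwd (hn : 0 < n) (ρ : ℕ → σ) (c : BInd n → Bool)
    (hns : ¬ (minModel (C.bk ρ) c).satCQ (pathCQ σ C.m ρ C.FL C.TL)) :
    ∃ col : Bool → Bool, col true ≠ col false ∧ ∀ w k, c (C.ct (w, k)) = col w := by
  haveI : NeZero n := ⟨hn.ne'⟩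
  have hstep : ∀ w k, c (C.ct (w, k)) = true → c (C.ct (w, k - 1)) = true := by
    intro w k h1
    by_contra h2
    rw [Bool.not_eq_true] at h2
    apply hns
    apply sat_of_copy C ρ c (.inl (w, k))
    · rintro p hp ⟨w', k'⟩ ⟨h3, h4⟩
      simp only at h3 h4
      subst h3
      rcases h4 with ⟨h4, rfl⟩ | ⟨h4, rfl⟩
      · exact h1
      · exact absurd (C.hcT w' k) (by rw [← h4]; exact C.hdis p hp)
    · rintro p hp ⟨w', k'⟩ ⟨h3, h4⟩
      simp only at h3 h4
      subst h3
      rcases h4 with ⟨h4, rfl⟩ | ⟨h4, rfl⟩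
      · exact absurd hp (by rw [h4]; exact C.hdis _ (C.hcF w' k'))
      · exact h2
  have hdown : ∀ w k (l : ℕ), c (C.ct (w, k)) = true → c (C.ct (w, k - l)) = true := by
    intro w k l h1
    induction l with
    | zero => simpa using h1
    | succ l ih =>
      have := hstep _ _ ih
      rwa [sub_sub, ← Nat.cast_succ] at this
  have hall : ∀ w k j, c (C.ct (w, k)) = true → c (C.ct (w, j)) = true := by
    intro w k j h1
    have := hdown w k (k - j).val h1
    rw [ZMod.natCast_zmod_val] at this
    simpa using this
  have hconst : ∀ w k j, c (C.ct (w, k)) = c (C.ct (w, j)) := by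
    intro w k j
    have h1 := hall w k j
    have h2 := hall w j k
    cases h3 : c (C.ct (w, k)) <;> cases h4 : c (C.ct (w, j)) <;> simp_all
  refine ⟨fun w => c (C.ct (w, 0)), ?_, fun w k => hconst w k 0⟩
  intro he
  simp only at he
  have hf := C.hdis
  cases h1 : c (C.ct (false, 0))
  · apply hns
    apply sat_of_copy C ρ c (.inr true)
    · rintro p hp κ h3
      rcases Wk.onQT.1 h3 with h4 | h4
      · exact absurd C.t1T (by rw [← h4.1]; exact C.hdis p hp)
      · exact absurd C.ttT (by rw [← h4.1]; exact C.hdis p hp)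
    · rintro p hp κ h3
      rcases Wk.onQT.1 h3 with ⟨_, rfl⟩ | ⟨_, rfl⟩
      · rw [hconst _ _ 0, he, h1]
      · rw [hconst _ _ 0, h1]
  · apply hns
    apply sat_of_copy C ρ c (.inr false)
    · rintro p hp κ h3
      rcases Wk.onQF.1 h3 with ⟨_, rfl⟩ | ⟨_, rfl⟩
      · rw [hconst _ _ 0, he, h1]
      · rw [hconst _ _ 0, h1]
    · rintro p hp κ h3
      rcases Wk.onQF.1 h3 with h4 | h4
      · exact absurd hp (by rw [h4.1]; exact C.hdis _ C.f1F)
      · exact absurd hp (by rw [h4.1]; exact C.hdis _ C.f2F)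

/-- Folding the tail of `q_F` and the head of `q_T` into the wheels. -/
noncomputable def Cfg.phi : BInd n → BInd n
  | .inl x => .inl x
  | .inr (false, v) => if C.f2 < v then .inl (false, C.iB false, v) else .inr (false, v)
  | .inr (true, v) => if v < C.t1 then .inl (true, C.jB true + 1, v) else .inr (true, v)

theorem phi_ct (κ : Bool × ZMod n) : C.phi (C.ct κ) = C.ct κ := rfl

theorem phi_emb (X : Cp n) (p : ℕ) (hp : p < C.m) : ∃ Y, C.emb Y p = C.phi (C.emb X p) ∧
    C.emb Y (p + 1) = C.phi (C.emb X (p + 1)) ∧ (Y = .inr false → p < C.f2) ∧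
    (Y = .inr true → C.t1 ≤ p) := by
  have f12 := C.f12
  have t1tt := C.t1tt
  have t1f1 := C.t1f1
  rcases X with ⟨w, k⟩ | b
  · exact ⟨.inl (w, k), rfl, rfl, by simp, by simp⟩
  cases b
  · by_cases h1 : p < C.f2
    · refine ⟨.inr false, ?_, ?_, fun _ => h1, by simp⟩
      · simp only [Cfg.emb, embF]
        split_ifs with h2
        · rfl
        · omega
        · simp only [Cfg.phi]; rw [if_neg (by omega)]
      · simp only [Cfg.emb, embF]
        split_ifs with h2 h3
        · rfl
        · rfl
        · simp only [Cfg.phi]; rw [if_neg (by omega)]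
    · obtain ⟨a1, a2⟩ := C.ci false
      refine ⟨.inl (false, C.iB false), ?_, ?_, by simp, by simp⟩
      · simp only [Cfg.emb, embF, bwNorm]
        rw [if_neg (by omega), if_neg (by omega)]
        split_ifs with h2
        · simp [Cfg.phi, a2, h2]
        · simp only [Cfg.phi]; rw [if_pos (by omega)]
      · simp only [Cfg.emb, embF, bwNorm]
        rw [if_neg (by omega), if_neg (by omega), if_neg (by omega)]
        simp only [Cfg.phi]; rw [if_pos (by omega)]
  · by_cases h1 : C.t1 ≤ p
    · refine ⟨.inr true, ?_, ?_, by simp, fun _ => h1⟩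
      · simp only [Cfg.emb, embT]
        split_ifs with h2 h3
        · rfl
        · rfl
        · simp only [Cfg.phi]; rw [if_neg (by omega)]
      · simp only [Cfg.emb, embT]
        split_ifs with h2 h3
        · rfl
        · rfl
        · simp only [Cfg.phi]; rw [if_neg (by omega)]
    · obtain ⟨a1, a2⟩ := Wk.cj1 (c := C) (by omega) true
      refine ⟨.inl (true, C.jB true + 1), ?_, ?_, by simp, by simp⟩
      · simp only [Cfg.emb, embT, bwNorm]
        rw [if_neg (by omega), if_neg (by omega), if_neg (by omega)]
        simp only [Cfg.phi]; rw [if_pos (by omega)]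
      · simp only [Cfg.emb, embT, bwNorm]
        by_cases h2 : p + 1 = C.t1
        · rw [if_pos (by omega), if_pos h2]
          simp [Cfg.phi]
        · rw [if_neg (by omega), if_neg h2, if_neg (by omega)]
          simp only [Cfg.phi]; rw [if_pos (by omega)]

theorem phi_lab (X : Cp n) (p : ℕ) (hno : ∀ κ, ¬ C.On X p κ) :
    ∃ Y, C.phi (C.emb X p) = C.emb Y p ∧ ∀ κ, ¬ C.On Y p κ := by
  have f12 := C.f12
  have t1tt := C.t1tt
  have t1f1 := C.t1f1
  have hfm := Wk.f1_lt_m (c := C)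
  have key : ∀ w k, p ≠ C.cT w k → p ≠ C.cF w k → ∀ κ, ¬ C.On (.inl (w, k)) p κ := by
    intro w k h1 h2 κ h3
    rcases (Wk.onW.1 h3).2 with h4 | h4
    · exact h2 h4.1
    · exact h1 h4.1
  rw [emb_non C hno]
  rcases X with ⟨w, k⟩ | b
  · exact ⟨.inl (w, k), by rw [emb_non C hno]; rfl, hno⟩
  cases b
  · by_cases h1 : C.f2 < p
    · obtain ⟨a1, a2⟩ := C.ci false
      have := key false (C.iB false) (by omega) (by omega)
      refine ⟨.inl (false, C.iB false), ?_, this⟩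
      rw [emb_non C this]
      simp [nonC, Cfg.phi, h1]
    · exact ⟨.inr false, by rw [emb_non C hno]; simp [nonC, Cfg.phi, h1], hno⟩
  · by_cases h1 : p < C.t1
    · obtain ⟨a1, a2⟩ := Wk.cj1 (c := C) (by omega) true
      have := key true (C.jB true + 1) (by omega) (by omega)
      refine ⟨.inl (true, C.jB true + 1), ?_, this⟩
      rw [emb_non C this]
      simp [nonC, Cfg.phi, h1]
    · exact ⟨.inr true, by rw [emb_non C hno]; simp [nonC, Cfg.phi, h1], hno⟩

theorem FS_phi (ρ : ℕ → σ) (c : BInd n → Bool) (a : BInd n)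
    (ha : (minModel (C.bk ρ) c).FS a) : (minModel (C.bk ρ) c).FS (C.phi a) := by
  rcases ha with ha | ha
  · obtain ⟨X, p, rfl, h1, h2⟩ := (F_bk C ρ a).1 ha
    obtain ⟨Y, h3, h4⟩ := phi_lab C X p h2
    rw [h3]
    exact Or.inl ((F_bk C ρ _).2 ⟨Y, p, rfl, h1, h4⟩)
  · obtain ⟨κ, rfl⟩ := (und_iff C ρ a).1 ha.1
    exact Or.inr ha

theorem TS_phi (ρ : ℕ → σ) (c : BInd n → Bool) (a : BInd n)
    (ha : (minModel (C.bk ρ) c).TS a) : (minModel (C.bk ρ) c).TS (C.phi a) := by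
  rcases ha with ha | ha
  · obtain ⟨X, p, rfl, h1, h2⟩ := (T_bk C ρ a).1 ha
    obtain ⟨Y, h3, h4⟩ := phi_lab C X p h2
    rw [h3]
    exact Or.inl ((T_bk C ρ _).2 ⟨Y, p, rfl, h1, h4⟩)
  · obtain ⟨κ, rfl⟩ := (und_iff C ρ a).1 ha.1
    exact Or.inr ha

theorem core_bwd (ρ : ℕ → σ) (c : BInd n → Bool) (col : Bool → Bool) (hcol : col true ≠ col false)
    (hc : ∀ w k, c (C.ct (w, k)) = col w) :
    ¬ (minModel (C.bk ρ) c).satCQ (pathCQ σ C.m ρ C.FL C.TL) := by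
  rw [sat_path]
  rintro ⟨h, h1, h2, h3⟩
  have ex : ∀ e, ∃ Y p, e < C.m → p < C.m ∧ C.emb Y p = C.phi (h e) ∧
      C.emb Y (p + 1) = C.phi (h (e + 1)) ∧ (Y = .inr false → p < C.f2) ∧
      (Y = .inr true → C.t1 ≤ p) := by
    intro e
    by_cases he : e < C.m
    · obtain ⟨X, p, hp, -, ha, hb⟩ := (R_bk C ρ _ _ _).1 (h1 e he)
      obtain ⟨Y, hY⟩ := phi_emb C X p hp
      exact ⟨Y, p, fun _ => ⟨hp, by rw [ha]; exact hY.1, by rw [hb]; exact hY.2.1, hY.2.2⟩⟩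
    · exact ⟨.inr true, 0, fun h => absurd h he⟩
  choose K P hKP using ex
  have W : Wk C := {
    K := K
    P := P
    col := col
    hcol := hcol
    hP := fun e he => (hKP e he).1
    nF := fun e he => (hKP e he).2.2.2.1
    nT := fun e he => (hKP e he).2.2.2.2
    step := by
      intro e he
      have a1 := (hKP e (by omega)).2.2.1
      have a2 := (hKP (e + 1) he).2.1
      rcases emb_inj C (a1.trans a2.symm) with ⟨h4, h5⟩ | h4
      · exact Or.inl ⟨h4.symm, h5.symm⟩
      · exact Or.inr h4
    F0 := by
      intro e he hf
      have := FS_phi C ρ c _ (h2 e hf)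
      rw [← (hKP e he).2.1, FS_emb] at this
      exact ⟨fun κ hκ => by rw [← this.1 κ hκ, ← hc κ.1 κ.2], this.2⟩
    F1 := by
      intro e he hf
      have := FS_phi C ρ c _ (h2 _ hf)
      rw [← (hKP e he).2.2.1, FS_emb] at this
      exact ⟨fun κ hκ => by rw [← this.1 κ hκ, ← hc κ.1 κ.2], this.2⟩
    T0 := by
      intro e he hf
      have := TS_phi C ρ c _ (h3 e hf)
      rw [← (hKP e he).2.1, TS_emb] at this
      exact ⟨fun κ hκ => by rw [← this.1 κ hκ, ← hc κ.1 κ.2], this.2⟩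
    T1 := by
      intro e he hf
      have := TS_phi C ρ c _ (h3 _ hf)
      rw [← (hKP e he).2.2.1, TS_emb] at this
      exact ⟨fun κ hκ => by rw [← this.1 κ hκ, ← hc κ.1 κ.2], this.2⟩ }
  exact W.absurd_walk

theorem core (hn : 0 < n) (ρ : ℕ → σ) (c : BInd n → Bool) :
    ¬ (minModel (C.bk ρ) c).satCQ (pathCQ σ C.m ρ C.FL C.TL) ↔
        (((∀ j : ZMod n, (minModel (C.bk ρ) c).TS (Sum.inl (true, j, C.cF true j))) ∧
          (∀ j : ZMod n, (minModel (C.bk ρ) c).FS (Sum.inl (false, j, C.cF false j)))) ∨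
         ((∀ j : ZMod n, (minModel (C.bk ρ) c).FS (Sum.inl (true, j, C.cF true j))) ∧
          (∀ j : ZMod n, (minModel (C.bk ρ) c).TS (Sum.inl (false, j, C.cF false j))))) := by
  have eF : ∀ w j, (minModel (C.bk ρ) c).FS (Sum.inl (w, j, C.cF w j)) ↔ c (C.ct (w, j)) = true :=
    fun w j => FS_ct C ρ c (w, j)
  have eT : ∀ w j, (minModel (C.bk ρ) c).TS (Sum.inl (w, j, C.cF w j)) ↔ c (C.ct (w, j)) = false :=
    fun w j => TS_ct C ρ c (w, j)
  simp only [eF, eT]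
  constructor
  · intro h
    obtain ⟨col, h1, h2⟩ := core_fwd C hn ρ c h
    simp only [h2]
    cases h3 : col true <;> cases h4 : col false <;> simp_all
  · rintro (⟨h1, h2⟩ | ⟨h1, h2⟩)
    · refine core_bwd C ρ c (fun w => !w) (by decide) ?_
      intro w k; cases w
      · exact h2 k
      · exact h1 k
    · refine core_bwd C ρ c (fun w => w) (by decide) ?_
      intro w k; cases w
      · exact h2 k
      · exact h1 k

end core


theorem cdist_add_le {n : ℕ} (a : ZMod n) (l : ℕ) (hl : l < n) : cdist (a + (l : ZMod n)) a ≤ l := by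
  unfold cdist
  rw [add_sub_cancel_left, ZMod.val_cast_of_lt hl]
  exact min_le_left _ _

theorem cdist_symm {n : ℕ} (a b : ZMod n) : cdist a b = cdist b a := by
  unfold cdist
  exact min_comm _ _

theorem sSup_facts {S : Set ℕ} {m : ℕ} (hS : S ⊆ Set.Iic m) (hne : S.Nonempty) :
    sSup S ∈ S ∧ ∀ x ∈ S, x ≤ sSup S := by
  have hb : BddAbove S := ⟨m, fun x hx => hS hx⟩
  exact ⟨Nat.sSup_mem hne hb, fun x hx => le_csSup hb hx⟩

theorem fF_facts {FL : Set ℕ} (hF2 : FL.Nontrivial) :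
    fstF FL ∈ FL ∧ sndF FL ∈ FL ∧ fstF FL < sndF FL ∧ ∀ x ∈ FL, x = fstF FL ∨ sndF FL ≤ x := by
  unfold fstF sndF
  have h1 : sInf FL ∈ FL := Nat.sInf_mem hF2.nonempty
  have hne : (FL \ {sInf FL}).Nonempty := by
    obtain ⟨y, hy, hy'⟩ := hF2.exists_ne (sInf FL)
    exact ⟨y, hy, hy'⟩
  have h2 := Nat.sInf_mem hne
  refine ⟨h1, h2.1, lt_of_le_of_ne (Nat.sInf_le h2.1) fun h => h2.2 h.symm, fun x hx => ?_⟩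
  by_cases h : x = sInf FL
  · exact Or.inl h
  · exact Or.inr (Nat.sInf_le ⟨hx, h⟩)

/-- Let `q` be a twinless path `2`-CQ with `t₁ ≺ f₁` and let
`B` be an `n`-bike for `q`, `n ≥ 4|q| + 2`, whose two cogwheels satisfy the
cogwheel conditions (i) and (ii) and whose contact choices are exactly as
prescribed by Lemma `l:bike` (`T`-connections, `T`-neighbourhood,
`F`-connections and `F`-neighbourhood).  Then for every minimal model `I` of
`cov_A` and `B`:  `I ⊭ q` iff either all contacts of `W_•` are in `T^I` and all
contacts of `W_∘` are in `F^I`, or all contacts of `W_•` are in `F^I` and all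
contacts of `W_∘` are in `T^I`. -/
theorem statement_17 {σ : Type} (m n : ℕ) (ρ : ℕ → σ) (FL TL : Set ℕ)
    (cT cF : Bool → ZMod n → ℕ) (iB jB : Bool → ZMod n)
    -- q is a twinless path 2-CQ with t₁ ≺ f₁
    (hm : 0 < m) (hFL : FL ⊆ Set.Iic m) (hTL : TL ⊆ Set.Iic m)
    (hdisj : ∀ i, ¬ (i ∈ FL ∧ i ∈ TL))
    (hF2 : FL.Nontrivial) (hT2 : TL.Nontrivial)
    (ht1f1 : fstT TL < fstF FL)
    -- size of the bike
    (hn : 4 * m + 2 ≤ n)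
    -- the two wheels are cogwheels satisfying conditions (i) and (ii)
    (hcT : ∀ w j, cT w j ∈ TL) (hcF : ∀ w j, cF w j ∈ FL)
    (hcond1 : ∀ w j, cT w j < cF w j)
    (hcond2 : ∀ w j, cT w (j + 1) < cF w j)
    -- in each wheel, the F- and T-connections are at contact-distance > 2|q|
    (hfar : ∀ w, 2 * m < cdist (iB w) (jB w))
    -- T-neighbourhood contact choices
    (hTn1 : cT true (jB true) = boxT FL TL)
    (hTn2 : cF true (jB true) = if fstF FL < lastT TL then fstF FL else sndF FL)
    (hTn3 : cT false (jB false) = fstT TL)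
    (hTn4 : cF false (jB false) =
      if lastT TL < fstF FL ∧ lastT TL - last1T TL = fstF FL - lastT TL
      then sndF FL else fstF FL)
    (hTn5 : ∀ (w : Bool) (o : ℤ), o ≠ 0 → o.natAbs ≤ m →
      cT w (jB w + (o : ZMod n)) = fstT TL ∧ cF w (jB w + (o : ZMod n)) = fstF FL)
    -- F-neighbourhood contact choices
    (hFn1 : ∀ w, cT w (iB w) = fstT TL ∧ cF w (iB w) = sndF FL)
    (hFn2 : ∀ (w : Bool) (k : ℕ), 0 < k → k ≤ m →
      cT w (iB w - (k : ZMod n)) = fstT TL ∧ cF w (iB w - (k : ZMod n)) = fstF FL)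
    (hFn3 : ∀ (w : Bool) (l : ℕ), 1 ≤ l → l ≤ m →
      cT w (iB w + (l : ZMod n)) =
        (if lastT TL < fstF FL ∧ sndF FL - fstF FL < fstF FL - fstT TL
         then fstT TL else boxT FL TL) ∧
      cF w (iB w + (l : ZMod n)) =
        (if lastT TL < fstF FL ∧ fstF FL - fstT TL ≤ sndF FL - fstF FL
         then sndF FL else fstF FL))
    -- the bike, with F-connections f₁, f₂ and T-connections t₁ and t_△/t_last
    (B : Set (At σ (BInd n)))
    (hB : B = bike σ n (pathCQ σ m ρ FL TL) cT cF iB jB (fstF FL) (sndF FL)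
      (fstT TL) (if fstF FL < lastT TL then triT FL TL else lastT TL)) :
    ∀ c : BInd n → Bool,
      (¬ (minModel B c).satCQ (pathCQ σ m ρ FL TL) ↔
        (((∀ j : ZMod n, (minModel B c).TS (Sum.inl (true, j, cF true j))) ∧
          (∀ j : ZMod n, (minModel B c).FS (Sum.inl (false, j, cF false j)))) ∨
         ((∀ j : ZMod n, (minModel B c).FS (Sum.inl (true, j, cF true j))) ∧
          (∀ j : ZMod n, (minModel B c).TS (Sum.inl (false, j, cF false j)))))) := by
  intro c
  have hnpos : 0 < n := by omega
  haveI : NeZero n := ⟨by omega⟩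
  obtain ⟨f1F, f2F, f12, fmin⟩ := fF_facts hF2
  have t1T : fstT TL ∈ TL := Nat.sInf_mem hT2.nonempty
  have tmin : ∀ x ∈ TL, fstT TL ≤ x := fun x hx => Nat.sInf_le hx
  obtain ⟨lT, lmax⟩ : lastT TL ∈ TL ∧ ∀ x ∈ TL, x ≤ lastT TL := sSup_facts hTL hT2.nonempty
  obtain ⟨⟨l1T, l1ne⟩, l1max⟩ : last1T TL ∈ TL \ {lastT TL} ∧
      ∀ x ∈ TL \ {lastT TL}, x ≤ last1T TL := by
    apply sSup_facts (m := m) (fun x hx => hTL hx.1)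
    obtain ⟨y, hy, hy'⟩ := hT2.exists_ne (sSup TL)
    exact ⟨y, hy, hy'⟩
  obtain ⟨⟨bxT, bxf⟩, bxmax⟩ : (boxT FL TL ∈ TL ∧ boxT FL TL < fstF FL) ∧
      ∀ x ∈ {t | t ∈ TL ∧ t < fstF FL}, x ≤ boxT FL TL := by
    exact sSup_facts (S := {t | t ∈ TL ∧ t < fstF FL}) (m := m) (fun x hx => hTL hx.1)
      ⟨fstT TL, t1T, ht1f1⟩
  have l1lt : last1T TL < lastT TL := lt_of_le_of_ne (lmax _ l1T) l1ne
  have hnel : fstF FL ≠ lastT TL := fun h => hdisj _ ⟨f1F, h ▸ lT⟩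
  have t1l : fstT TL < lastT TL := lt_of_le_of_lt (tmin _ l1T) l1lt
  -- the second connection node of the copy of the query at the `T`-end
  have htri : fstF FL < lastT TL → (triT FL TL ∈ TL ∧ fstF FL < triT FL TL) ∧
      ∀ x ∈ TL, fstF FL < x → triT FL TL ≤ x := by
    intro h
    have hne : {t | t ∈ TL ∧ fstF FL < t}.Nonempty := ⟨_, lT, h⟩
    exact ⟨Nat.sInf_mem hne, fun x hx hx' => Nat.sInf_le ⟨hx, hx'⟩⟩
  have hbl : ¬ fstF FL < lastT TL → boxT FL TL = lastT TL := by
    intro h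
    exact le_antisymm (lmax _ bxT) (bxmax _ ⟨lT, by omega⟩)
  have hd1 : ∀ w (l : ℕ), l ≤ m → iB w + l ≠ jB w := by
    intro w l hl h
    have h1 := cdist_add_le (iB w) l (by omega)
    have h2 := hfar w
    rw [h, cdist_symm] at h1
    omega
  have hd2 : ∀ w (l : ℕ), l ≤ m → jB w + l ≠ iB w := by
    intro w l hl h
    have h1 := cdist_add_le (jB w) l (by omega)
    have h2 := hfar w
    rw [h] at h1
    omega
  have hl0 : ∀ l : ℕ, 1 ≤ l → l ≤ m → (l : ZMod n) ≠ 0 := by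
    intro l h1 h2 h
    have := ZMod.val_cast_of_lt (n := n) (a := l) (by omega)
    rw [h, ZMod.val_zero] at this
    omega
  let C : Cfg n :=
    { m := m
      FL := FL
      TL := TL
      cT := cT
      cF := cF
      iB := iB
      jB := jB
      f1 := fstF FL
      f2 := sndF FL
      t1 := fstT TL
      bx := boxT FL TL
      tt := if fstF FL < lastT TL then triT FL TL else lastT TL
      tn := if lastT TL < fstF FL ∧ sndF FL - fstF FL < fstF FL - fstT TL
         then fstT TL else boxT FL TL
      cn := if lastT TL < fstF FL ∧ fstF FL - fstT TL ≤ sndF FL - fstF FL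
         then sndF FL else fstF FL
      hFm := fun x hx => hFL hx
      hTm := fun x hx => hTL hx
      hdis := fun x hx hx' => hdisj x ⟨hx, hx'⟩
      f1F := f1F
      f2F := f2F
      f12 := f12
      fmin := fmin
      t1T := t1T
      tmin := tmin
      t1f1 := ht1f1
      bxT := bxT
      bxf := bxf
      bxmax := fun x hx hx' => bxmax x ⟨hx, hx'⟩
      t1tt := by
        split_ifs with h
        · exact ht1f1.trans (htri h).1.2
        · exact t1l
      ttT := by
        split_ifs with h
        · exact (htri h).1.1
        · exact lT
      hcT := hcT
      hcF := hcF
      cond1 := hcond1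
      cond2 := hcond2
      hij := fun w h => hd1 w 0 (Nat.zero_le _) (by simpa using h)
      nei := by
        intro w l h1 h2
        refine ⟨fun h => hl0 l h1 h2 (by simpa using h), hd1 w l h2,
          fun h => hl0 l h1 h2 (by simpa using h), fun h => hd2 w l h2 ?_⟩
        rw [← h]; ring
      nej := by
        intro w l h1 h2
        refine ⟨hd2 w l h2, fun h => hl0 l h1 h2 (by simpa using h), fun h => hd1 w l h2 ?_,
          fun h => hl0 l h1 h2 (by simpa using h)⟩
        rw [← h]; ring
      shape := by
        by_cases h : fstF FL < lastT TL
        · right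
          rw [if_pos h] at hTn2
          rw [if_neg (by omega)] at hTn4
          rw [if_pos h]
          exact ⟨(htri h).1.2, (htri h).2, hTn2, hTn4⟩
        · left
          have hb := hbl h
          rw [if_neg h] at hTn2
          rw [if_neg h]
          refine ⟨fun x hx => hb ▸ lmax x hx, hb.symm, hTn2, last1T TL, l1T, hb ▸ l1lt,
            fun x hx hx' => l1max x ⟨hx, ?_⟩, ?_⟩
          · intro hxl
            rw [hb] at hx'
            exact absurd hxl (ne_of_lt hx')
          · split_ifs at hTn4 with h'
            · right
              exact ⟨hTn4, by omega⟩
            · left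
              exact ⟨hTn4, by omega⟩
      cTj1 := hTn1
      cTj0 := hTn3
      cj := by
        intro w l h1 h2
        have ha := hTn5 w (l : ℤ) (by omega) (by omega)
        have hb := hTn5 w (-(l : ℤ)) (by omega) (by omega)
        push_cast at ha hb
        rw [← sub_eq_add_neg] at hb
        exact ⟨ha.1, ha.2, hb.1, hb.2⟩
      ci := hFn1
      cim := hFn2
      cip := hFn3
      shape2 := by
        by_cases h : fstF FL < lastT TL
        · right; right
          rw [if_neg (by omega), if_neg (by omega), if_pos h]
          exact ⟨rfl, rfl, (htri h).1.2, (htri h).2⟩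
        · have hb := hbl h
          by_cases h' : sndF FL - fstF FL < fstF FL - fstT TL
          · left
            rw [if_pos (by omega), if_neg (by omega)]
            exact ⟨rfl, rfl, by omega⟩
          · right; left
            rw [if_neg (by omega), if_pos (by omega)]
            exact ⟨rfl, rfl, by omega, by omega, fun x hx => hb ▸ lmax x hx⟩ }
  subst hB
  exact core C hnpos ρ c

end DS
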